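/- arXiv:1608.01390 — 2 statements merged into one kernel-verified Lean document; each statement's English description precedes it below -/
import Mathlib

section
/- Let K be an imaginary quadratic field, let L₁ and L₂ be rank-1 K-lattices of conductors f₁ and f₂, set f = lcm(f₁, f₂), and let F be a positive integer divisible by f. Then the abelian group Ext¹_{O_F}(L₁, L₂) is isomorphic to (ℤ/(F/f)ℤ)²; in particular it is finite of cardinality (F/f)² and is annihilated by F/f. -/
noncomputable section

variable (K : Type) [Field K] [NumberField K]

/-- The underlying set of the order `ℤ + m·O_K` of conductor `m` in `K`. -/
def orderSet (m : ℕ) : Set K :=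
  {x : K | ∃ (a : ℤ) (y : NumberField.RingOfIntegers K),
    x = (a : K) + (m : K) * algebraMap (NumberField.RingOfIntegers K) K y}

/-- The order `ℤ + m·O_K` of conductor `m`, as a subring of `K`. -/
def orderSubring (m : ℕ) : Subring K where
  carrier := orderSet K m
  add_mem' := by
    rintro x y ⟨a, u, rfl⟩ ⟨b, v, rfl⟩
    exact ⟨a + b, u + v, by rw [map_add]; push_cast; ring⟩
  zero_mem' := ⟨0, 0, by simp⟩
  one_mem' := ⟨1, 0, by simp⟩
  neg_mem' := by
    rintro x ⟨a, u, rfl⟩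
    exact ⟨-a, -u, by rw [map_neg]; push_cast; ring⟩
  mul_mem' := by
    rintro x y ⟨a, u, rfl⟩ ⟨b, v, rfl⟩
    refine ⟨a * b, a • v + b • u + (m : ℤ) • (u * v), ?_⟩
    rw [map_add, map_add, map_zsmul, map_zsmul, map_zsmul, map_mul]
    rw [zsmul_eq_mul, zsmul_eq_mul, zsmul_eq_mul]
    push_cast
    ring

/-- `L` is a rank-1 `K`-lattice: a finitely generated `ℤ`-submodule of `K`
spanning `K` over `ℚ`. -/
def IsLat (L : Submodule ℤ K) : Prop :=
  L.FG ∧ Submodule.span ℚ (L : Set K) = ⊤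

/-- The multiplier ring `R(L) = {α ∈ K : α·L ⊆ L}` of a lattice, as a `ℤ`-submodule. -/
def multLat (L : Submodule ℤ K) : Submodule ℤ K where
  carrier := {α : K | ∀ x ∈ L, α * x ∈ L}
  add_mem' := by
    intro a b ha hb x hx
    rw [add_mul]; exact L.add_mem (ha x hx) (hb x hx)
  zero_mem' := by intro x hx; rw [zero_mul]; exact L.zero_mem
  smul_mem' := by
    intro n a ha x hx
    rw [smul_mul_assoc]; exact L.smul_mem n (ha x hx)

/-- `L` has conductor `c`, i.e. the multiplier ring of `L` is the order `ℤ + c·O_K`. -/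
def HasCond (L : Submodule ℤ K) (c : ℕ) : Prop :=
  0 < c ∧ (multLat K L : Set K) = orderSet K c

/-- A lattice `L` with `R·L ⊆ L` is a module over the subring `R ⊆ K`. -/
def latticeModule (R : Subring K) (L : Submodule ℤ K)
    (h : ∀ r ∈ R, ∀ x ∈ L, r * x ∈ L) : Module R L :=
  { smul := fun r x => ⟨(r : K) * (x : K), h r r.2 x x.2⟩
    one_smul := fun x => by ext; exact one_mul _
    mul_smul := fun r s x => by ext; exact mul_assoc _ _ _
    smul_zero := fun r => by ext; exact mul_zero _
    smul_add := fun r x y => by ext; exact mul_add _ _ _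
    add_smul := fun r s x => by ext; exact add_mul _ _ _
    zero_smul := fun x => by ext; exact zero_mul _ }

/-- The `R`-module `Ext¹_R(L₁, L₂)` for lattices `L₁, L₂` stable under the subring
`R ⊆ K`. -/
def extOrderObj (R : Subring K) (L₁ L₂ : Submodule ℤ K)
    (h₁ : ∀ r ∈ R, ∀ x ∈ L₁, r * x ∈ L₁)
    (h₂ : ∀ r ∈ R, ∀ x ∈ L₂, r * x ∈ L₂) : ModuleCat R := by
  letI := latticeModule K R L₁ h₁
  letI := latticeModule K R L₂ h₂
  exact ((Ext R (ModuleCat R) 1).obj (Opposite.op (ModuleCat.of R L₁))).obj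
    (ModuleCat.of R L₂)

universe u

section
open CategoryTheory

variable {R : Type u} [CommRing R] {P L : Type u} [AddCommGroup P] [Module R P]
  [AddCommGroup L] [Module R L]

/-- The periodic projective resolution `⋯ → P → P → P → L` with differentials alternating between
`A` and `B` and augmentation `π`. -/
noncomputable def periodicResolution [Module.Projective R P] (A B : P →ₗ[R] P) (π : P →ₗ[R] L)
    (hπ : Function.Surjective π) (hAπ : Function.Exact A π) (hBA : Function.Exact B A)
    (hAB : Function.Exact A B) : ProjectiveResolution (ModuleCat.of R L) where
  complex := HomologicalComplex.alternatingConst (ModuleCat.of R P)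
    (φ := ModuleCat.ofHom B) (ψ := ModuleCat.ofHom A)
    (ModuleCat.hom_ext hBA.linearMap_comp_eq_zero) (ModuleCat.hom_ext hAB.linearMap_comp_eq_zero)
    fun _ _ => ComplexShape.down_nat_odd_add
  projective _ := inferInstanceAs <| Projective (ModuleCat.of R P)
  π := (ChainComplex.toSingle₀Equiv _ _).symm ⟨ModuleCat.ofHom π, by
    simpa using! ModuleCat.hom_ext hAπ.linearMap_comp_eq_zero⟩
  quasiIso := ⟨fun m => by
    induction m with
    | zero =>
      rw [ChainComplex.quasiIsoAt₀_iff, ShortComplex.quasiIso_iff_of_zeros' _ rfl rfl rfl]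
      constructor
      · apply ModuleCat.shortComplex_exact
        simpa [HomologicalComplex.alternatingConst, ChainComplex.toSingle₀Equiv] using! hAπ
      · rw [ModuleCat.epi_iff_surjective]
        simpa [ChainComplex.toSingle₀Equiv] using! hπ
    | succ m _ =>
      rw [quasiIsoAt_iff_exactAt' (hL := ChainComplex.exactAt_succ_single_obj ..),
          HomologicalComplex.exactAt_iff' _ (m + 2) (m + 1) m (by simp) (by simp)]
      rcases Nat.even_or_odd (m + 1) with hm | hm
      · exact ShortComplex.exact_of_iso (HomologicalComplex.alternatingConstScIsoEven _ _ _ _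
          (by simp) (by simp) hm).symm (ModuleCat.shortComplex_exact _ hAB)
      · exact ShortComplex.exact_of_iso (HomologicalComplex.alternatingConstScIsoOdd _ _ _ _
          (by simp) (by simp) hm).symm (ModuleCat.shortComplex_exact _ hBA)⟩

lemma ShortComplex.nonempty_homology_addEquiv (S : ShortComplex (ModuleCat.{u} R))
    {Q : Type*} [AddCommGroup Q] (f : LinearMap.ker S.g.hom →+ Q) (hf : Function.Surjective f)
    (hker : ∀ x, f x = 0 ↔ ∃ y, S.f y = x) : Nonempty (S.homology ≃+ Q) := by
  refine ⟨S.moduleCatHomologyIso.toLinearEquiv.toAddEquiv.trans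
    ((QuotientAddGroup.quotientAddEquivOfEq (N := f.ker) ?_).trans
      (QuotientAddGroup.quotientKerEquivOfSurjective f hf))⟩
  ext x
  rw [AddMonoidHom.mem_ker, hker]
  exact exists_congr fun y => Subtype.ext_iff

lemma nonempty_ext_one_addEquiv [Module.Projective R P] {Y : Type u} [AddCommGroup Y] [Module R Y]
    (A B : P →ₗ[R] P) (π : P →ₗ[R] L)
    (hπ : Function.Surjective π) (hAπ : Function.Exact A π) (hBA : Function.Exact B A)
    (hAB : Function.Exact A B) {Q : Type*} [AddCommGroup Q]
    (f : LinearMap.ker (LinearMap.lcomp R Y B) →+ Q) (hf : Function.Surjective f)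
    (hker : ∀ x, f x = 0 ↔ ∃ y : P →ₗ[R] Y, y ∘ₗ A = x) :
    Nonempty ((((Ext R (ModuleCat R) 1).obj (Opposite.op (ModuleCat.of R L))).obj
    (ModuleCat.of R Y) : Type u) ≃+ Q) := by
  let res := periodicResolution A B π hπ hAπ hBA hAB
  let S := (res.complex.linearYonedaObj R (ModuleCat.of R Y)).sc' 0 1 2
  have e1 : ((Ext R (ModuleCat R) 1).obj (Opposite.op (ModuleCat.of R L))).obj
    (ModuleCat.of R Y) ≅ S.homology := res.isoExt 1 _ ≪≫
      ShortComplex.homologyMapIso (HomologicalComplex.isoSc' _ 0 1 2 (by simp) (by simp))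
  have hSf : ∀ y : ModuleCat.of R P ⟶ ModuleCat.of R Y, S.f y = ModuleCat.ofHom A ≫ y := by
    intro y
    simp [S, res, periodicResolution]
    rfl
  have hSg : ∀ y : ModuleCat.of R P ⟶ ModuleCat.of R Y, S.g y = ModuleCat.ofHom B ≫ y := by
    intro y
    simp [S, res, periodicResolution]
    rfl
  let g : LinearMap.ker S.g.hom →+ LinearMap.ker (LinearMap.lcomp R Y B) :=
    { toFun x := ⟨ModuleCat.Hom.hom (x.1 : ModuleCat.of R P ⟶ ModuleCat.of R Y), by
        have := (hSg x.1).symm.trans x.2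
        exact congrArg ModuleCat.Hom.hom this⟩
      map_zero' := rfl
      map_add' _ _ := rfl }
  have hg : Function.Surjective g := fun x =>
    ⟨⟨(ModuleCat.ofHom x.1 : ModuleCat.of R P ⟶ ModuleCat.of R Y),
      (hSg _).trans (ModuleCat.hom_ext x.2)⟩, rfl⟩
  obtain ⟨e2⟩ := ShortComplex.nonempty_homology_addEquiv S (f.comp g) (hf.comp hg) (by
    intro x
    rw [AddMonoidHom.comp_apply, hker]
    constructor
    · rintro ⟨y, hy⟩
      exact ⟨(ModuleCat.ofHom y : ModuleCat.of R P ⟶ ModuleCat.of R Y),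
        (hSf _).trans (ModuleCat.hom_ext hy)⟩
    · rintro ⟨y, hy⟩
      exact ⟨ModuleCat.Hom.hom (y : ModuleCat.of R P ⟶ ModuleCat.of R Y),
        congrArg ModuleCat.Hom.hom ((hSf y).symm.trans hy)⟩)
  exact ⟨e1.toLinearEquiv.toAddEquiv.trans e2⟩
end

section
open TensorProduct
variable {R : Type u} [CommRing R] {τ : R}

lemma TensorProduct.exists_eq_one_tmul_add_tmul {M : Type*} [AddCommGroup M]
    (hspan : ∀ r : R, ∃ a b : ℤ, r = a + b * τ) (p : R ⊗[ℤ] M) :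
    ∃ x y : M, p = 1 ⊗ₜ x + τ ⊗ₜ y := by
  induction p with
  | zero => exact ⟨0, 0, by simp⟩
  | add p q hp hq =>
    obtain ⟨x, y, rfl⟩ := hp
    obtain ⟨x', y', rfl⟩ := hq
    exact ⟨x + x', y + y', by simp only [tmul_add]; abel⟩
  | tmul r x =>
    obtain ⟨a, b, rfl⟩ := hspan r
    refine ⟨a • x, b • x, ?_⟩
    rw [add_tmul, ← smul_tmul, ← smul_tmul, zsmul_one, zsmul_eq_mul]

lemma TensorProduct.eq_zero_of_one_tmul_add_tmul_eq_zero {M : Type*} [AddCommGroup M]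
    (hspan : ∀ r : R, ∃ a b : ℤ, r = a + b * τ)
    (hind : ∀ a b : ℤ, (a : R) + b * τ = 0 → a = 0 ∧ b = 0) {x y : M}
    (h : (1 : R) ⊗ₜ[ℤ] x + τ ⊗ₜ y = 0) : y = 0 := by
  have huniq : ∀ a b a' b' : ℤ, (a : R) + b * τ = a' + b' * τ → b = b' := fun a b a' b' e =>
    sub_eq_zero.1 (hind (a - a') (b - b') (by push_cast; linear_combination e)).2
  choose a b hab using hspan
  let c : R →+ ℤ := AddMonoidHom.mk' b fun r s => by
    apply huniq (a (r + s)) _ (a r + a s)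
    rw [← hab]
    push_cast
    linear_combination hab r + hab s
  have h1 : c 1 = 0 := huniq (a 1) _ 1 _ ((hab 1).symm.trans (by simp))
  have hτ : c τ = 1 := huniq (a τ) _ 0 _ ((hab τ).symm.trans (by simp))
  have := congrArg ((TensorProduct.lid ℤ M) ∘ (c.toIntLinearMap.rTensor M)) h
  simpa [h1, hτ] using this

variable {L Y : Type u} [AddCommGroup L] [Module R L] [AddCommGroup Y] [Module R Y]

/-- The endomorphism `a ⊗ 1 - 1 ⊗ b` of `R ⊗[ℤ] L`. -/
noncomputable def tensorDiff (L : Type u) [AddCommGroup L] [Module R L] (a b : R) :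
    R ⊗[ℤ] L →ₗ[R] R ⊗[ℤ] L :=
  a • LinearMap.id - (Module.toModuleEnd ℤ L b).baseChange R

lemma tensorDiff_tmul (a b r : R) (x : L) :
    tensorDiff L a b (r ⊗ₜ x) = (a * r) ⊗ₜ x - r ⊗ₜ (b • x) := by
  simp [tensorDiff, smul_tmul']

theorem nonempty_ext_one_addEquiv_of_quadratic [Module.Free ℤ L] (t n : ℤ)
    (hspan : ∀ r : R, ∃ a b : ℤ, r = a + b * τ)
    (hind : ∀ a b : ℤ, (a : R) + b * τ = 0 → a = 0 ∧ b = 0)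
    (hτ : τ * τ = t * τ - n)
    (N : AddSubgroup (L →+ Y)) (hN : ∀ φ, φ ∈ N ↔ ∀ x, τ • φ x + φ (τ • x) = t • φ x)
    {Q : Type*} [AddCommGroup Q] (f : N →+ Q) (hf : Function.Surjective f)
    (hker : ∀ φ, f φ = 0 ↔ ∃ ψ : L →+ Y, ∀ x, φ.1 x = τ • ψ x - ψ (τ • x)) :
    Nonempty ((((Ext R (ModuleCat R) 1).obj (Opposite.op (ModuleCat.of R L))).obj
      (ModuleCat.of R Y) : Type u) ≃+ Q) := by
  let A := tensorDiff L τ τ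
  let B := tensorDiff L τ (t - τ)
  let π : R ⊗[ℤ] L →ₗ[R] L := LinearMap.liftBaseChange R LinearMap.id
  have hπ (r : R) (x : L) : π (r ⊗ₜ x) = r • x := by simp [π]
  have hdiff (x y : L) (s : R) : tensorDiff L τ s (1 ⊗ₜ x + τ ⊗ₜ y) =
      1 ⊗ₜ (-(s • x) - n • y) + τ ⊗ₜ (x + t • y - s • y) := by
    rw [map_add, tensorDiff_tmul, tensorDiff_tmul, hτ, mul_one, sub_tmul]
    rw [← zsmul_eq_mul, smul_tmul, ← zsmul_one, smul_tmul]
    simp only [tmul_add, tmul_sub, tmul_neg]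
    abel
  have hA (x : L) : A (1 ⊗ₜ x) = 1 ⊗ₜ (-(τ • x)) + τ ⊗ₜ x := by
    simpa using hdiff x 0 τ
  have hB (x : L) : B (1 ⊗ₜ x) = 1 ⊗ₜ (-((t - τ) • x)) + τ ⊗ₜ x := by
    simpa using hdiff x 0 (t - τ)
  have hτ' (y : L) : τ • τ • y = t • τ • y - n • y := by
    rw [smul_smul, hτ, sub_smul, mul_smul]; simp only [Int.cast_smul_eq_zsmul]
  have hAπ : Function.Exact A π := by
    intro p
    obtain ⟨x, y, rfl⟩ := exists_eq_one_tmul_add_tmul hspan p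
    constructor
    · intro h
      rw [map_add, hπ, hπ, one_smul] at h
      exact ⟨1 ⊗ₜ y, by rw [hA, ← eq_neg_of_add_eq_zero_left h]⟩
    · rintro ⟨q, hq⟩
      obtain ⟨x', y', rfl⟩ := exists_eq_one_tmul_add_tmul hspan q
      rw [← hq, hdiff, map_add, hπ, hπ, one_smul, smul_sub, smul_add, hτ', smul_comm τ t y']
      abel
  have hBA : Function.Exact B A := by
    intro p
    obtain ⟨x, y, rfl⟩ := exists_eq_one_tmul_add_tmul hspan p
    constructor
    · intro h
      rw [hdiff] at h
      have := eq_zero_of_one_tmul_add_tmul_eq_zero hspan hind h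
      refine ⟨1 ⊗ₜ y, ?_⟩
      rw [hB, sub_smul, Int.cast_smul_eq_zsmul]
      congr 2
      rw [← sub_eq_zero, ← neg_eq_zero, ← this]
      abel
    · rintro ⟨q, hq⟩
      obtain ⟨x', y', rfl⟩ := exists_eq_one_tmul_add_tmul hspan q
      rw [← hq, hdiff, hdiff]
      simp only [sub_smul, Int.cast_smul_eq_zsmul, smul_sub, smul_add, smul_neg, hτ',
        smul_comm τ (_ : ℤ) (_ : L)]
      convert add_zero (0 : R ⊗[ℤ] L) using 2
      · convert tmul_zero L (1 : R) using 2
        module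
      · convert tmul_zero L τ using 2
        module
  have hAB : Function.Exact A B := by
    intro p
    obtain ⟨x, y, rfl⟩ := exists_eq_one_tmul_add_tmul hspan p
    constructor
    · intro h
      rw [hdiff] at h
      have := eq_zero_of_one_tmul_add_tmul_eq_zero hspan hind h
      refine ⟨1 ⊗ₜ y, ?_⟩
      rw [hA]
      congr 2
      rw [sub_smul, Int.cast_smul_eq_zsmul] at this
      rw [← sub_eq_zero, ← neg_eq_zero, ← this]
      abel
    · rintro ⟨q, hq⟩
      obtain ⟨x', y', rfl⟩ := exists_eq_one_tmul_add_tmul hspan q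
      rw [← hq, hdiff, hdiff]
      simp only [sub_smul, Int.cast_smul_eq_zsmul, smul_sub, smul_add, smul_neg, hτ',
        smul_comm τ (_ : ℤ) (_ : L)]
      convert add_zero (0 : R ⊗[ℤ] L) using 2
      · convert tmul_zero L (1 : R) using 2
        module
      · convert tmul_zero L τ using 2
        module
  let res (h : R ⊗[ℤ] L →ₗ[R] Y) : L →+ Y :=
    h.toAddMonoidHom.comp (TensorProduct.mk ℤ R L 1).toAddMonoidHom
  let ext (ψ : L →+ Y) : R ⊗[ℤ] L →ₗ[R] Y := LinearMap.liftBaseChange R ψ.toIntLinearMap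
  have hext (ψ : L →+ Y) (x : L) : ext ψ (1 ⊗ₜ x) = ψ x := by simp [ext]
  have hτmul (h : R ⊗[ℤ] L →ₗ[R] Y) (x : L) : h (τ ⊗ₜ x) = τ • h (1 ⊗ₜ x) := by
    rw [← map_smul, smul_tmul', smul_eq_mul, mul_one]
  have hexteq {h h' : R ⊗[ℤ] L →ₗ[R] Y} (H : ∀ x, h (1 ⊗ₜ x) = h' (1 ⊗ₜ x)) : h = h' := by
    ext x; exact H x
  have hkerB (h : R ⊗[ℤ] L →ₗ[R] Y) :
      h ∈ LinearMap.ker (LinearMap.lcomp R Y B) ↔ res h ∈ N := by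
    rw [hN, LinearMap.mem_ker]
    have key (x : L) : h (B (1 ⊗ₜ x)) = τ • res h x + res h (τ • x) - t • res h x := by
      rw [hB, map_add, hτmul, sub_smul, Int.cast_smul_eq_zsmul, tmul_neg, tmul_sub,
        tmul_smul, map_neg, map_sub, map_zsmul]
      simp only [res, AddMonoidHom.comp_apply, LinearMap.toAddMonoidHom_coe, mk_apply]
      abel
    constructor
    · intro H x
      rw [← sub_eq_zero, ← key]
      exact LinearMap.congr_fun H _
    · intro H
      exact hexteq fun x => (key x).trans (sub_eq_zero.2 (H x))
  let g : LinearMap.ker (LinearMap.lcomp R Y B) →+ N :=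
    { toFun h := ⟨res h.1, (hkerB _).1 h.2⟩
      map_zero' := rfl
      map_add' _ _ := rfl }
  have hg : Function.Surjective g := fun φ => by
    have : res (ext φ.1) = φ.1 := AddMonoidHom.ext (hext _)
    exact ⟨⟨ext φ.1, (hkerB _).2 (by rw [this]; exact φ.2)⟩, Subtype.ext this⟩
  refine nonempty_ext_one_addEquiv A B π (fun x => ⟨1 ⊗ₜ x, by simp [hπ]⟩) hAπ hBA hAB
    (f.comp g) (hf.comp hg) fun h => ?_
  rw [AddMonoidHom.comp_apply, hker]
  have key (y : R ⊗[ℤ] L →ₗ[R] Y) (x : L) :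
      y (A (1 ⊗ₜ x)) = τ • y (1 ⊗ₜ x) - y (1 ⊗ₜ (τ • x)) := by
    rw [hA, map_add, hτmul, tmul_neg, map_neg]; abel
  constructor
  · rintro ⟨ψ, hψ⟩
    refine ⟨ext ψ, hexteq fun x => ?_⟩
    rw [LinearMap.comp_apply, key, hext, hext]
    exact (hψ x).symm
  · rintro ⟨y, hy⟩
    refine ⟨res y, fun x => ?_⟩
    exact (LinearMap.congr_fun hy (1 ⊗ₜ x)).symm.trans (key y x)

end

section
variable {L L₁ L₂ : Type*} [AddCommGroup L] [AddCommGroup L₁] [AddCommGroup L₂]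

open Matrix in
lemma exists_mul_sub_mul_sub_mul_eq_one {M : Matrix (Fin 2) (Fin 2) ℤ} {t n : ℤ}
    (hM : M * M = t • M - n • 1)
    (hprim : ∀ (d s : ℤ) (M' : Matrix (Fin 2) (Fin 2) ℤ), M = s • 1 + d • M' → IsUnit d) :
    ∃ X : Matrix (Fin 2) (Fin 2) ℤ, t • X - M * X - X * M = 1 := by
  obtain ⟨d, hd⟩ := (IsPrincipalIdealRing.principal
    (Ideal.span {M 0 1, M 1 0, M 0 0 - M 1 1})).principal
  replace hd : Ideal.span {M 0 1, M 1 0, M 0 0 - M 1 1} = Ideal.span {d} := hd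
  have hdvd : ∀ m ∈ ({M 0 1, M 1 0, M 0 0 - M 1 1} : Set ℤ), d ∣ m := fun m hm =>
    Ideal.mem_span_singleton.1 (hd ▸ Ideal.subset_span hm)
  obtain ⟨q, hq⟩ := hdvd (M 0 1) (by simp)
  obtain ⟨r, hr⟩ := hdvd (M 1 0) (by simp)
  obtain ⟨p, hp⟩ := hdvd (M 0 0 - M 1 1) (by simp)
  have hu := hprim d (M 1 1) !![p, q; r, 0] (by
    ext i j
    simp only [Matrix.add_apply, Matrix.smul_apply, smul_eq_mul]
    fin_cases i <;> fin_cases j <;> simp [hq, hr, ← hp])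
  have h1 : (1 : ℤ) ∈ Ideal.span {M 0 1, M 1 0, M 0 0 - M 1 1} := by
    rw [hd, Ideal.span_singleton_eq_top.2 hu]; trivial
  obtain ⟨z, y, x, h1⟩ := Submodule.mem_span_triple.1 h1
  simp only [smul_eq_mul] at h1
  have e (i j : Fin 2) := congrFun (congrFun hM i) j
  have e00 := e 0 0
  have e01 := e 0 1
  have e10 := e 1 0
  have e11 := e 1 1
  simp only [Matrix.mul_apply, Fin.sum_univ_two, Matrix.sub_apply, Matrix.smul_apply,
    smul_eq_mul, Matrix.one_apply_eq, Fin.isValue, ne_eq, zero_ne_one, one_ne_zero,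
    not_false_eq_true, Matrix.one_apply_ne] at e00 e01 e10 e11
  have htr : t = M 0 0 + M 1 1 := by
    linear_combination (M 0 0 + M 1 1 - t) * h1 + z * (-e01) + y * (-e10) + x * (e11 - e00)
  refine ⟨!![-x, -y; -z, x], ?_⟩
  ext i j
  simp only [Matrix.sub_apply, Matrix.smul_apply, Matrix.mul_apply, Fin.sum_univ_two, smul_eq_mul]
  fin_cases i <;> fin_cases j <;> simp <;> rw [htr]
  · linear_combination h1
  · ring
  · ring
  · linear_combination h1

lemma exists_smul_sub_sub_eq [Module.Free ℤ L] [Module.Finite ℤ L]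
    (hL : Module.finrank ℤ L = 2) (T : L →+ L) (t n : ℤ)
    (hT : ∀ x, T (T x) = t • T x - n • x)
    (hprim : ∀ (d s : ℤ) (T' : L →+ L), (∀ x, T x = s • x + d • T' x) → IsUnit d) :
    ∃ X : L →+ L, ∀ x, t • X x - T (X x) - X (T x) = x := by
  let b := Module.finBasisOfFinrankEq ℤ L hL
  let e := LinearMap.toMatrixAlgEquiv b
  obtain ⟨X, hX⟩ := exists_mul_sub_mul_sub_mul_eq_one (M := e T.toIntLinearMap) (t := t) (n := n)
    (by
      rw [← map_mul, ← map_zsmul, ← map_one e, ← map_zsmul, ← map_sub]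
      exact congrArg e (LinearMap.ext hT))
    (fun d s M' h => by
      refine hprim d s (e.symm M').toAddMonoidHom fun x => ?_
      rw [← map_one e, ← e.apply_symm_apply M', ← map_zsmul, ← map_zsmul, ← map_add] at h
      exact LinearMap.congr_fun (e.injective h) x)
  refine ⟨(e.symm X).toAddMonoidHom, fun x => ?_⟩
  rw [← map_one e, ← e.apply_symm_apply X, ← map_zsmul, ← map_mul, ← map_mul, ← map_sub,
    ← map_sub] at hX
  exact LinearMap.congr_fun (e.injective hX) x

/-- The additive maps `φ` intertwining `S₁` with the conjugate `t - S₂` of `S₂`. -/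
def antiIntertwiners (S₁ : L₁ →+ L₁) (S₂ : L₂ →+ L₂) (t : ℤ) : AddSubgroup (L₁ →+ L₂) where
  carrier := {φ | ∀ x, S₂ (φ x) + φ (S₁ x) = t • φ x}
  zero_mem' x := by simp
  add_mem' {φ ψ} hφ hψ x := by
    simp only [AddMonoidHom.add_apply, map_add, smul_add, ← hφ x, ← hψ x]; abel
  neg_mem' {φ} hφ x := by
    simp only [AddMonoidHom.neg_apply, map_neg, smul_neg, ← hφ x]; abel

lemma mem_antiIntertwiners {S₁ : L₁ →+ L₁} {S₂ : L₂ →+ L₂} {t : ℤ} {φ : L₁ →+ L₂} :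
    φ ∈ antiIntertwiners S₁ S₂ t ↔ ∀ x, S₂ (φ x) + φ (S₁ x) = t • φ x := Iff.rfl

lemma mem_antiIntertwiners_iff_exists_commutator {S₁ : L₁ →+ L₁} {S₂ : L₂ →+ L₂} {t n : ℤ}
    (hS₁ : ∀ x, S₁ (S₁ x) = t • S₁ x - n • x) (hS₂ : ∀ x, S₂ (S₂ x) = t • S₂ x - n • x)
    {e₁ e₂ : ℤ} (hcop : IsCoprime e₁ e₂)
    {X₁ : L₁ →+ L₁} (hX₁ : ∀ x, t • X₁ x - S₁ (X₁ x) - X₁ (S₁ x) = e₁ • x)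
    {X₂ : L₂ →+ L₂} (hX₂ : ∀ x, t • X₂ x - S₂ (X₂ x) - X₂ (S₂ x) = e₂ • x) {φ : L₁ →+ L₂} :
    φ ∈ antiIntertwiners S₁ S₂ t ↔ ∃ ψ : L₁ →+ L₂, ∀ x, φ x = S₂ (ψ x) - ψ (S₁ x) := by
  constructor
  · intro hφ
    obtain ⟨u, v, huv⟩ := hcop
    refine ⟨u • φ.comp X₁ - v • X₂.comp φ, fun x => ?_⟩
    have h1 := congrArg φ (hX₁ x)
    have h2 := hX₂ (φ x)
    have h3 := hφ (X₁ x)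
    have h4 := congrArg X₂ (hφ x)
    simp only [map_sub, map_add, map_zsmul, AddMonoidHom.sub_apply, AddMonoidHom.smul_apply,
      AddMonoidHom.comp_apply] at *
    have h5 : φ x = u • e₁ • φ x + v • e₂ • φ x := by
      rw [smul_smul, smul_smul, ← add_smul, huv, one_smul]
    linear_combination (norm := module) h5 - u • h1 - v • h2 - u • h3 - v • h4
  · rintro ⟨ψ, hψ⟩ x
    rw [hψ, hψ, map_sub, hS₁, hS₂, map_sub, map_zsmul, map_zsmul]
    module

lemma LinearMap.finrank_range_add_finrank_ker_of_int [Module.Finite ℤ L₁] (φ : L₁ →ₗ[ℤ] L₂) :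
    Module.finrank ℤ (LinearMap.range φ) + Module.finrank ℤ (LinearMap.ker φ) =
      Module.finrank ℤ L₁ := by
  rw [← φ.quotKerEquivRange.finrank_eq, Submodule.finrank_quotient_add_finrank]

lemma eq_zero_of_apply_eq_zero [Module.Free ℤ L₁] [Module.Finite ℤ L₁]
    [IsAddTorsionFree L₂] (hL₁ : Module.finrank ℤ L₁ = 2) {x y : L₁}
    (hind : ∀ a b : ℤ, a • x + b • y = 0 → a = 0 ∧ b = 0) {φ : L₁ →+ L₂}
    (hx : φ x = 0) (hy : φ y = 0) : φ = 0 := by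
  let φ' := φ.toIntLinearMap
  have hli : LinearIndependent ℤ ![(⟨x, hx⟩ : LinearMap.ker φ'), ⟨y, hy⟩] := by
    rw [LinearIndependent.pair_iff]
    exact fun a b h => hind a b (congrArg Subtype.val h)
  have h2 := hli.fintype_card_le_finrank
  have hsum := φ'.finrank_range_add_finrank_ker_of_int
  rw [Fintype.card_fin] at h2
  have h0 : LinearMap.range φ' = ⊥ := Submodule.finrank_eq_zero.1 (by omega)
  ext z
  exact LinearMap.congr_fun (LinearMap.range_eq_bot.1 h0) z

lemma finrank_antiIntertwiners [Module.Free ℤ L₁] [Module.Finite ℤ L₁]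
    [Module.Free ℤ L₂] [Module.Finite ℤ L₂] (hL₁ : Module.finrank ℤ L₁ = 2)
    (hL₂ : Module.finrank ℤ L₂ = 2) {S₁ : L₁ →+ L₁} {S₂ : L₂ →+ L₂} {t : ℤ} {x : L₁}
    (hind : ∀ a b : ℤ, a • x + b • S₁ x = 0 → a = 0 ∧ b = 0)
    (hN : ∀ φ, φ ∈ antiIntertwiners S₁ S₂ t ↔ ∃ ψ : L₁ →+ L₂, ∀ x, φ x = S₂ (ψ x) - ψ (S₁ x)) :
    Module.finrank ℤ (antiIntertwiners S₁ S₂ t) = 2 := by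
  have : IsAddTorsionFree L₂ := Module.isTorsionFree_int_iff_isAddTorsionFree.1 inferInstance
  let D : (L₁ →+ L₂) →ₗ[ℤ] (L₁ →+ L₂) := AddMonoidHom.toIntLinearMap
    (AddMonoidHom.mk' (fun ψ => S₂.comp ψ - ψ.comp S₁) fun ψ ψ' => by ext z; simp; abel)
  have hD : ∀ ψ z, D ψ z = S₂ (ψ z) - ψ (S₁ z) := fun ψ z => rfl
  have hrange : AddSubgroup.toIntSubmodule (antiIntertwiners S₁ S₂ t) = LinearMap.range D := by
    ext φ
    refine (hN φ).trans (exists_congr fun ψ => ?_)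
    rw [DFunLike.ext_iff]
    exact forall_congr' fun z => eq_comm
  have hle (P : Submodule ℤ (L₁ →+ L₂)) (hP : ∀ φ ∈ P, φ x = 0 → φ (S₁ x) = 0) :
      Module.finrank ℤ P ≤ 2 := by
    rw [← hL₂]
    let ev : P →ₗ[ℤ] L₂ :=
      AddMonoidHom.toIntLinearMap ((AddMonoidHom.eval x).comp P.toAddSubgroup.subtype)
    refine LinearMap.finrank_le_finrank_of_injective (f := ev) ?_
    refine (injective_iff_map_eq_zero ev).2 fun φ h => Subtype.ext ?_
    exact eq_zero_of_apply_eq_zero hL₁ hind h (hP φ.1 φ.2 h)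
  have h1 := hle (LinearMap.range D) fun φ hφ h => by
    rw [← hrange] at hφ
    simpa [h] using hφ x
  have h2 := hle (LinearMap.ker D) fun φ hφ h => by
    have := hD φ x
    rw [LinearMap.mem_ker.1 hφ] at this
    simpa [h] using this
  have hsum := D.finrank_range_add_finrank_ker_of_int
  have h4 : Module.finrank ℤ (L₁ →+ L₂) = 4 := by
    rw [(addMonoidHomLequivInt ℤ).finrank_eq, Module.finrank_linearMap, hL₁, hL₂]
  have : Module.finrank ℤ (antiIntertwiners S₁ S₂ t) = Module.finrank ℤ (LinearMap.range D) := by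
    rw [← hrange]; rfl
  omega

theorem exists_surjective_prod_zmod [Module.Free ℤ L] [Module.Finite ℤ L]
    (hL : Module.finrank ℤ L = 2) (e : ℕ) :
    ∃ f : L →+ ZMod e × ZMod e, Function.Surjective f ∧ ∀ x, f x = 0 ↔ ∃ y, x = e • y := by
  let b := Module.finBasisOfFinrankEq ℤ L hL
  let c (i : Fin 2) : L →+ ZMod e := (Int.castAddHom (ZMod e)).comp (b.coord i).toAddMonoidHom
  have hc (i : Fin 2) (x : L) : c i x = (b.repr x i : ZMod e) := rfl
  refine ⟨(c 0).prod (c 1), fun ⟨u, v⟩ => ?_, fun x => ?_⟩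
  · obtain ⟨u, rfl⟩ := ZMod.intCast_surjective u
    obtain ⟨v, rfl⟩ := ZMod.intCast_surjective v
    exact ⟨u • b 0 + v • b 1, by simp [hc]⟩
  · simp only [AddMonoidHom.prod_apply, hc, Prod.mk_eq_zero, ZMod.intCast_zmod_eq_zero_iff_dvd]
    constructor
    · rintro ⟨⟨u, hu⟩, v, hv⟩
      refine ⟨u • b 0 + v • b 1, ?_⟩
      rw [← b.sum_repr x, Fin.sum_univ_two, hu, hv, smul_add, mul_smul, mul_smul]
      simp only [natCast_zsmul]
    · rintro ⟨y, rfl⟩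
      simp
end

section
variable {R : Type u} [CommRing R] {L Y : Type u} [AddCommGroup L] [Module R L]
  [AddCommGroup Y] [Module R Y]

theorem nonempty_ext_one_addEquiv_prod_zmod [Module.Free ℤ L] [Module.Finite ℤ L]
    [Module.Free ℤ Y] [Module.Finite ℤ Y] (hL : Module.finrank ℤ L = 2)
    (hY : Module.finrank ℤ Y = 2) {τ : R} {e : ℕ} (he : e ≠ 0) {t n : ℤ}
    (hspan : ∀ r : R, ∃ a b : ℤ, r = a + b * τ)
    (hind : ∀ a b : ℤ, (a : R) + b * τ = 0 → a = 0 ∧ b = 0)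
    (hτ : τ * τ = (e * t : ℤ) * τ - (e ^ 2 * n : ℤ)) {S₁ : L →+ L} {S₂ : Y →+ Y}
    (hτ₁ : ∀ x, τ • x = (e : ℤ) • S₁ x) (hτ₂ : ∀ x, τ • x = (e : ℤ) • S₂ x)
    {x : L} (hx : ∀ a b : ℤ, a • x + b • S₁ x = 0 → a = 0 ∧ b = 0)
    (hN : ∀ φ, φ ∈ antiIntertwiners S₁ S₂ t ↔ ∃ ψ : L →+ Y, ∀ x, φ x = S₂ (ψ x) - ψ (S₁ x)) :
    Nonempty ((((Ext R (ModuleCat R) 1).obj (Opposite.op (ModuleCat.of R L))).obj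
      (ModuleCat.of R Y) : Type u) ≃+ ZMod e × ZMod e) := by
  have : IsAddTorsionFree Y := Module.isTorsionFree_int_iff_isAddTorsionFree.1 inferInstance
  have he' : (e : ℤ) ≠ 0 := by exact_mod_cast he
  have : Module.Finite ℤ (antiIntertwiners S₁ S₂ t) := inferInstanceAs
    (Module.Finite ℤ (AddSubgroup.toIntSubmodule (antiIntertwiners S₁ S₂ t)))
  have : Module.Free ℤ (antiIntertwiners S₁ S₂ t) := inferInstanceAs
    (Module.Free ℤ (AddSubgroup.toIntSubmodule (antiIntertwiners S₁ S₂ t)))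
  obtain ⟨f, hf, hker⟩ := exists_surjective_prod_zmod
    (finrank_antiIntertwiners hL hY hx hN) e
  refine nonempty_ext_one_addEquiv_of_quadratic (e * t) (e ^ 2 * n) hspan hind hτ _
    (fun φ => ?_) f hf fun φ => ?_
  · rw [mem_antiIntertwiners]
    refine forall_congr' fun z => ?_
    rw [hτ₁, hτ₂, map_zsmul, ← smul_add, mul_smul]
    exact (zsmul_right_injective he').eq_iff.symm
  · have key (ψ : L →+ Y) (z : L) :
        τ • ψ z - ψ (τ • z) = e • (S₂ (ψ z) - ψ (S₁ z)) := by
      rw [hτ₁, hτ₂, map_zsmul, ← smul_sub, natCast_zsmul]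
    rw [hker]
    constructor
    · rintro ⟨φ', rfl⟩
      obtain ⟨ψ, hψ⟩ := (hN _).1 φ'.2
      exact ⟨ψ, fun z => by rw [key, ← hψ]; rfl⟩
    · rintro ⟨ψ, hψ⟩
      refine ⟨⟨S₂.comp ψ - ψ.comp S₁, (hN _).2 ⟨ψ, fun _ => rfl⟩⟩, ?_⟩
      ext z
      rw [hψ, key]
      rfl

end

section
variable {K : Type} [Field K]

open NumberField

/-- `1, ω` is a `ℤ`-basis of the ring of integers of `K`. -/
def IsIntegralGenerator (ω : 𝓞 K) : Prop :=
  (∀ y : 𝓞 K, ∃ a b : ℤ, y = a + b * ω) ∧ ∀ a b : ℤ, (a : K) + b * ω = 0 → a = 0 ∧ b = 0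

lemma RingOfIntegers.exists_intCast_eq_of_mul_eq [NumberField K] {k m : ℤ} (hk : k ≠ 0) {y : 𝓞 K}
    (h : (k : 𝓞 K) * y = m) : ∃ a : ℤ, y = a := by
  have hy : (y : K) = algebraMap ℚ K (m / k) := by
    have := congrArg (algebraMap (𝓞 K) K) h
    rw [map_mul, map_intCast, map_intCast] at this
    rw [map_div₀, map_intCast, map_intCast, eq_div_iff (by exact_mod_cast hk), mul_comm, this]
  have hint : IsIntegral ℤ (algebraMap ℚ K (m / k)) := hy ▸ y.isIntegral_coe
  rw [isIntegral_algebraMap_iff (algebraMap ℚ K).injective] at hint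
  obtain ⟨a, ha⟩ := IsIntegrallyClosed.isIntegral_iff.1 hint
  refine ⟨a, RingOfIntegers.ext ?_⟩
  rw [hy, ← ha]
  simp

lemma exists_isIntegralGenerator [NumberField K] (hdeg : Module.finrank ℚ K = 2) :
    ∃ ω : 𝓞 K, IsIntegralGenerator ω := by
  let M : Submodule ℤ (𝓞 K) := Submodule.span ℤ {1}
  have hM (y : 𝓞 K) : y ∈ M ↔ ∃ a : ℤ, y = a := by
    simp only [M, Submodule.mem_span_singleton, zsmul_one, eq_comm]
  have htf : Module.IsTorsionFree ℤ (𝓞 K ⧸ M) := by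
    refine Module.isTorsionFree_iff_smul_eq_zero.2 fun k q h => ?_
    obtain ⟨y, rfl⟩ := M.mkQ_surjective q
    rw [← map_zsmul, Submodule.mkQ_apply, Submodule.Quotient.mk_eq_zero, hM] at h
    obtain ⟨m, hm⟩ := h
    refine or_iff_not_imp_left.2 fun hk => ?_
    rw [Submodule.mkQ_apply, Submodule.Quotient.mk_eq_zero, hM]
    exact RingOfIntegers.exists_intCast_eq_of_mul_eq hk (by rw [← hm, zsmul_eq_mul])
  have hrank : Module.finrank ℤ (𝓞 K ⧸ M) = 1 := by
    have h1 : Module.finrank ℤ M = 1 := by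
      have hli : LinearIndependent ℤ fun _ : Unit => (1 : 𝓞 K) := by simp
      have := finrank_span_eq_card hli
      rwa [Set.range_const, Fintype.card_unit] at this
    have := M.finrank_quotient_add_finrank
    rw [RingOfIntegers.rank, hdeg] at this
    omega
  obtain ⟨v, hv, hgen⟩ := finrank_eq_one_iff'.1 hrank
  obtain ⟨ω, rfl⟩ := M.mkQ_surjective v
  refine ⟨ω, fun y => ?_, fun a b h => ?_⟩
  · obtain ⟨b, hb⟩ := hgen (M.mkQ y)
    rw [← map_zsmul, Submodule.mkQ_apply, Submodule.mkQ_apply, eq_comm, Submodule.Quotient.eq,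
      hM] at hb
    obtain ⟨a, ha⟩ := hb
    exact ⟨a, b, by rw [← ha, zsmul_eq_mul]; ring⟩
  · have h' : b • ω = (-a : ℤ) := by
      apply RingOfIntegers.ext
      rw [zsmul_eq_mul]
      simp only [map_mul, map_intCast]
      push_cast
      linear_combination h
    have hb : b • M.mkQ ω = 0 := by
      rw [← map_zsmul, Submodule.mkQ_apply, Submodule.Quotient.mk_eq_zero, hM]
      exact ⟨_, h'⟩
    have hb0 := (smul_eq_zero.1 hb).resolve_right hv
    refine ⟨?_, hb0⟩
    simpa [hb0] using h

lemma mem_orderSubring_iff {ω : 𝓞 K} (hω : IsIntegralGenerator ω) {m : ℕ} {x : K} :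
    x ∈ orderSubring K m ↔ ∃ a b : ℤ, x = a + b * (m * ω) := by
  constructor
  · rintro ⟨a, y, rfl⟩
    obtain ⟨c, d, rfl⟩ := hω.1 y
    refine ⟨a + m * c, d, ?_⟩
    simp only [map_add, map_mul, map_intCast]
    push_cast
    ring
  · rintro ⟨a, b, rfl⟩
    refine ⟨a, b * ω, ?_⟩
    simp only [map_mul, map_intCast]
    ring

lemma orderSubring_le_of_dvd {m m' : ℕ} (h : m ∣ m') : orderSubring K m' ≤ orderSubring K m := by
  obtain ⟨k, rfl⟩ := h
  rintro _ ⟨a, y, rfl⟩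
  refine ⟨a, k * y, ?_⟩
  simp only [map_mul, map_natCast]
  push_cast
  ring

variable {L : Submodule ℤ K}

lemma HasCond.mem_iff {c : ℕ} (hc : HasCond K L c) {r : K} :
    r ∈ orderSubring K c ↔ ∀ x ∈ L, r * x ∈ L :=
  (Set.ext_iff.1 hc.2 r).symm

lemma HasCond.mul_mem {c m : ℕ} (hc : HasCond K L c) (hm : c ∣ m) :
    ∀ r ∈ orderSubring K m, ∀ x ∈ L, r * x ∈ L := fun _ hr =>
  hc.mem_iff.1 (orderSubring_le_of_dvd hm hr)

/-- Multiplication by an element stabilising a lattice. -/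
def mulEnd (L : Submodule ℤ K) (r : K) (hr : ∀ x ∈ L, r * x ∈ L) : L →+ L where
  toFun x := ⟨r * x, hr x x.2⟩
  map_zero' := Subtype.ext (mul_zero r)
  map_add' _ _ := Subtype.ext (mul_add r _ _)

lemma mulEnd_mulEnd {r : K} (hr : ∀ x ∈ L, r * x ∈ L) {t n : ℤ} (h : r * r = t * r - n) (x : L) :
    mulEnd L r hr (mulEnd L r hr x) = t • mulEnd L r hr x - n • x := by
  apply Subtype.ext
  simp only [mulEnd, AddMonoidHom.coe_mk, ZeroHom.coe_mk, Submodule.coe_sub, Submodule.coe_smul,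
    zsmul_eq_mul]
  linear_combination (x : K) * h

variable [NumberField K]

lemma IsLat.isLattice (hL : IsLat K L) : Submodule.IsLattice ℚ L := ⟨hL.1, hL.2⟩

lemma IsLat.finrank_eq (hL : IsLat K L) : Module.finrank ℤ L = Module.finrank ℚ K := by
  have := hL.isLattice
  exact congrArg Cardinal.toNat (Submodule.IsLattice.rank' ℚ L)

lemma IsLat.free (hL : IsLat K L) : Module.Free ℤ L := by
  have := hL.isLattice
  exact Submodule.IsLattice.free ℚ L

lemma IsLat.finite (hL : IsLat K L) : Module.Finite ℤ L := Module.Finite.iff_fg.2 hL.1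

lemma HasCond.exists_smul_sub_sub_eq (hdeg : Module.finrank ℚ K = 2) {c k f : ℕ}
    (hL : IsLat K L) (hc : HasCond K L c)
    (hf : f = c * k) {ω : 𝓞 K} (hω : IsIntegralGenerator ω) {t n : ℤ}
    (htn : (ω : K) * ω = t * ω - n) (hr : ∀ x ∈ L, (f * ω : K) * x ∈ L) :
    ∃ X : L →+ L, ∀ x, (f * t) • X x - mulEnd L _ hr (X x) - X (mulEnd L _ hr x) = (k : ℤ) • x := by
  have := hL.free
  have := hL.finite
  have h2 := hL.finrank_eq.trans hdeg
  have hr' : ∀ x ∈ L, (c * ω : K) * x ∈ L :=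
    hc.mem_iff.1 ((mem_orderSubring_iff hω).2 ⟨0, 1, by simp⟩)
  have : Nontrivial L := Module.nontrivial_of_finrank_pos (R := ℤ) (by omega)
  obtain ⟨x₀, hx₀⟩ := exists_ne (0 : L)
  have hx₀' : (x₀ : K) ≠ 0 := by simpa using hx₀
  have hc0 : (c : ℤ) ≠ 0 := by exact_mod_cast hc.1.ne'
  obtain ⟨X, hX⟩ := _root_.exists_smul_sub_sub_eq h2 (mulEnd L _ hr') (c * t) (c ^ 2 * n)
    (mulEnd_mulEnd hr' (by push_cast; linear_combination (c : K) ^ 2 * htn)) (by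
      intro d s T hT
      have hTK (x : L) : (c * ω : K) * x = s * x + d * T x := by
        simpa [mulEnd] using congrArg Subtype.val (hT x)
      have hd : d ≠ 0 := by
        rintro rfl
        have h0 : ((-s : ℤ) : K) + (c : ℤ) * ω = 0 := by
          apply (mul_eq_zero.1 _).resolve_right hx₀'
          push_cast
          linear_combination hTK x₀
        exact hc0 (hω.2 _ _ h0).2
      have hdK : (d : K) ≠ 0 := by exact_mod_cast hd
      obtain ⟨a, b, hab⟩ := (mem_orderSubring_iff hω).1 (hc.mem_iff (r := (c * ω - s) / d) |>.2
        fun x hx => by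
          convert (T ⟨x, hx⟩).2 using 1
          rw [div_mul_eq_mul_div, div_eq_iff hdK]
          linear_combination hTK ⟨x, hx⟩)
      rw [div_eq_iff hdK] at hab
      have := (hω.2 (-s - a * d) (c * (1 - b * d)) (by push_cast; linear_combination hab)).2
      refine isUnit_iff_exists_inv'.2 ⟨b, ?_⟩
      linarith [(mul_eq_zero.1 this).resolve_left hc0])
  refine ⟨X, fun x => ?_⟩
  have hfr (y : L) : mulEnd L _ hr y = (k : ℤ) • mulEnd L _ hr' y := by
    apply Subtype.ext
    simp only [mulEnd, AddMonoidHom.coe_mk, ZeroHom.coe_mk, Submodule.coe_smul, zsmul_eq_mul, hf]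
    push_cast
    ring
  rw [hfr, hfr, map_zsmul, hf]
  linear_combination (norm := (push_cast; module)) (k : ℤ) • hX x

end

/-- For an imaginary quadratic field `K`, lattices `L₁, L₂` of conductors `f₁, f₂` with
`f = lcm(f₁, f₂)` and `F` divisible by `f`, the abelian group `Ext¹_{O_F}(L₁, L₂)` is
isomorphic to `(ℤ/(F/f)ℤ)²`; in particular it has cardinality `(F/f)²` and is
annihilated by `F/f`. -/
theorem ext_group_structure
    (hdeg : Module.finrank ℚ K = 2)
    (himag : IsEmpty (K →+* ℝ))
    (L₁ L₂ : Submodule ℤ K) (hL₁ : IsLat K L₁) (hL₂ : IsLat K L₂)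
    (f₁ f₂ : ℕ) (hc₁ : HasCond K L₁ f₁) (hc₂ : HasCond K L₂ f₂)
    (f : ℕ) (hf : f = Nat.lcm f₁ f₂)
    (F : ℕ) (hF0 : 0 < F) (hF : f ∣ F) :
    (∀ r ∈ orderSubring K F, ∀ x ∈ L₁, r * x ∈ L₁) ∧
    (∀ r ∈ orderSubring K F, ∀ x ∈ L₂, r * x ∈ L₂) ∧
    ∀ (h₁ : ∀ r ∈ orderSubring K F, ∀ x ∈ L₁, r * x ∈ L₁)
      (h₂ : ∀ r ∈ orderSubring K F, ∀ x ∈ L₂, r * x ∈ L₂),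
      Nonempty ((extOrderObj K (orderSubring K F) L₁ L₂ h₁ h₂ : Type) ≃+
          (ZMod (F / f) × ZMod (F / f))) ∧
      Nat.card (extOrderObj K (orderSubring K F) L₁ L₂ h₁ h₂ : Type) = (F / f) ^ 2 ∧
      ∀ x : (extOrderObj K (orderSubring K F) L₁ L₂ h₁ h₂ : Type), (F / f) • x = 0 := by
  have hf₁ : f₁ ∣ f := hf ▸ Nat.dvd_lcm_left f₁ f₂
  have hf₂ : f₂ ∣ f := hf ▸ Nat.dvd_lcm_right f₁ f₂
  refine ⟨hc₁.mul_mem (hf₁.trans hF), hc₂.mul_mem (hf₂.trans hF), fun h₁ h₂ => ?_⟩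
  suffices h : Nonempty ((extOrderObj K (orderSubring K F) L₁ L₂ h₁ h₂ : Type) ≃+
      (ZMod (F / f) × ZMod (F / f))) by
    refine ⟨h, ?_, fun x => ?_⟩
    · rw [Nat.card_congr h.some.toEquiv, Nat.card_prod, Nat.card_zmod, sq]
    · apply h.some.injective
      rw [map_nsmul, map_zero]
      ext <;> simp
  obtain ⟨e, rfl⟩ := hF
  have hf0 : 0 < f := Nat.pos_of_mul_pos_right hF0
  have he0 : e ≠ 0 := (Nat.pos_of_mul_pos_left hF0).ne'
  rw [Nat.mul_div_cancel_left e hf0]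
  obtain ⟨ω, hω⟩ := exists_isIntegralGenerator hdeg
  obtain ⟨n, t, htn⟩ : ∃ n t : ℤ, (ω : K) * ω = t * ω - n := by
    obtain ⟨a, b, h⟩ := hω.1 (ω * ω)
    refine ⟨-a, b, ?_⟩
    have := congrArg (algebraMap _ K) h
    simp only [map_add, map_mul, map_intCast] at this
    push_cast
    linear_combination this
  have hfω : (f * ω : K) ∈ orderSubring K f := (mem_orderSubring_iff hω).2 ⟨0, 1, by simp⟩
  have hr₁ := hc₁.mul_mem hf₁ _ hfω
  have hr₂ := hc₂.mul_mem hf₂ _ hfω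
  obtain ⟨g, a, b, hg, hab, hfa, hfb⟩ :=
    Nat.exists_coprime' (Nat.gcd_pos_of_pos_left f₂ hc₁.1)
  have hlcm : f = g * (a * b) := by
    rw [hf, hfa, hfb, Nat.lcm_mul_right, hab.lcm_eq_mul, mul_comm]
  obtain ⟨X₁, hX₁⟩ := hc₁.exists_smul_sub_sub_eq hdeg hL₁ (k := b)
    (by rw [hlcm, hfa]; ring) hω htn hr₁
  obtain ⟨X₂, hX₂⟩ := hc₂.exists_smul_sub_sub_eq hdeg hL₂ (k := a)
    (by rw [hlcm, hfb]; ring) hω htn hr₂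
  have hrel : (f * ω : K) * (f * ω) = (f * t : ℤ) * (f * ω) - (f ^ 2 * n : ℤ) := by
    push_cast; linear_combination (f : K) ^ 2 * htn
  have := hL₁.free
  have := hL₁.finite
  have := hL₂.free
  have := hL₂.finite
  have hrk₁ := hL₁.finrank_eq.trans hdeg
  have hrk₂ := hL₂.finrank_eq.trans hdeg
  have : Nontrivial L₁ := Module.nontrivial_of_finrank_pos (R := ℤ) (by omega)
  obtain ⟨x₀, hx₀⟩ := exists_ne (0 : L₁)
  have hx₀' : (x₀ : K) ≠ 0 := by simpa using hx₀
  have hind (m : ℕ) (hm : m ≠ 0) (a b : ℤ) (h : (a : K) + b * (m * ω) = 0) : a = 0 ∧ b = 0 := by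
    have := hω.2 a (b * m) (by push_cast; linear_combination h)
    exact ⟨this.1, by simpa [hm] using this.2⟩
  let _ := latticeModule K (orderSubring K (f * e)) L₁ h₁
  let _ := latticeModule K (orderSubring K (f * e)) L₂ h₂
  let τ : orderSubring K (f * e) :=
    ⟨(f * e : ℕ) * ω, (mem_orderSubring_iff hω).2 ⟨0, 1, by simp⟩⟩
  refine nonempty_ext_one_addEquiv_prod_zmod hrk₁ hrk₂ (τ := τ) he0 (t := f * t) (n := f ^ 2 * n)
    (fun r => ?_) (fun a b h => hind (f * e) hF0.ne' a b (by simpa [τ] using congrArg Subtype.val h))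
    ?_ (S₁ := mulEnd L₁ _ hr₁) (S₂ := mulEnd L₂ _ hr₂) (fun x => ?_) (fun x => ?_) (x := x₀)
    (fun a b h => hind f hf0.ne' a b ?_)
    fun φ => mem_antiIntertwiners_iff_exists_commutator (mulEnd_mulEnd hr₁ hrel)
      (mulEnd_mulEnd hr₂ hrel) (Nat.isCoprime_iff_coprime.2 hab.symm) hX₁ hX₂
  · obtain ⟨a, b, h⟩ := (mem_orderSubring_iff hω).1 r.2
    exact ⟨a, b, Subtype.ext (by simpa [τ] using h)⟩
  · apply Subtype.ext
    simp only [τ, Subring.coe_mul, AddSubgroupClass.coe_sub, Subring.coe_intCast]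
    push_cast
    linear_combination (f * e : K) ^ 2 * htn
  · apply Subtype.ext
    change ((f * e : ℕ) * ω : K) * x = _
    simp only [mulEnd, AddMonoidHom.coe_mk, ZeroHom.coe_mk, Submodule.coe_smul, zsmul_eq_mul]
    push_cast
    ring
  · apply Subtype.ext
    change ((f * e : ℕ) * ω : K) * x = _
    simp only [mulEnd, AddMonoidHom.coe_mk, ZeroHom.coe_mk, Submodule.coe_smul, zsmul_eq_mul]
    push_cast
    ring
  · apply (mul_eq_zero.1 _).resolve_right hx₀'
    have := congrArg Subtype.val h
    simp only [mulEnd, AddMonoidHom.coe_mk, ZeroHom.coe_mk, Submodule.coe_smul, zsmul_eq_mul,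
      Submodule.coe_add, Submodule.coe_zero] at this
    linear_combination this

end
end

section
/- Let K be an imaginary quadratic field and let τ₁, τ₂ ∈ K \ ℚ, so that L₁ = ℤ + ℤτ₁ and L₂ = ℤ + ℤτ₂ are rank-1 K-lattices; let f₁, f₂ be their conductors and f = lcm(f₁, f₂). Let z ∈ K, and let n be the order of z + L₁L₂ in the group K/(L₁L₂). Let L ⊆ K² be the ℤ-span of the four vectors (τ₂, 0), (1, 0), (z, τ₁), (0, 1). Then there exists γ ∈ GL₂(K) such that γ·L = O_{n·f} ⊕ (L₁L₂ + ℤz), where L₁L₂ + ℤz is the rank-1 K-lattice generated by the product lattice L₁L₂ and z. -/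
noncomputable section

variable (K : Type) [Field K] [NumberField K]

/-- The order `ℤ + m·O_K` of conductor `m`, as a `ℤ`-submodule of `K`. -/
def orderLat (m : ℕ) : Submodule ℤ K where
  carrier := orderSet K m
  add_mem' := by
    rintro x y ⟨a, u, rfl⟩ ⟨b, v, rfl⟩
    exact ⟨a + b, u + v, by rw [map_add]; push_cast; ring⟩
  zero_mem' := ⟨0, 0, by simp⟩
  smul_mem' := by
    rintro n x ⟨a, u, rfl⟩
    refine ⟨n * a, n • u, ?_⟩
    rw [map_zsmul, zsmul_eq_mul, zsmul_eq_mul]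
    push_cast
    ring

/-- The lattice `A ⊕ B = {(x,y) ∈ K² : x ∈ A, y ∈ B}` in `K²`. -/
def latPair (A B : Submodule ℤ K) : Submodule ℤ (Fin 2 → K) :=
  A.comap (LinearMap.proj (R := ℤ) (φ := fun _ : Fin 2 => K) 0) ⊓
    B.comap (LinearMap.proj (R := ℤ) (φ := fun _ : Fin 2 => K) 1)

theorem exists_int_modEq_of_primes (S : Finset ℕ) (hS : ∀ p ∈ S, p.Prime) (c : ℕ → ℤ) :
    ∃ x : ℤ, ∀ p ∈ S, (p : ℤ) ∣ x - c p := by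
  obtain ⟨x, hx⟩ := Ideal.exists_forall_sub_mem_ideal (R := ℤ) (ι := S)
    (I := fun p => Ideal.span {((p : ℕ) : ℤ)}) (fun p q hpq => by
      change IsCoprime (Ideal.span _) (Ideal.span _)
      rw [Ideal.isCoprime_span_singleton_iff]
      exact Nat.isCoprime_iff_coprime.mpr ((Nat.coprime_primes (hS p p.2) (hS q q.2)).mpr
        fun h => hpq (Subtype.ext h))) (fun p => c p)
  exact ⟨x, fun p hp => Ideal.mem_span_singleton.mp (hx ⟨p, hp⟩)⟩

/-- Two integer vectors are linearly independent modulo the prime `p`: some `2 × 2` minor is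
not divisible by `p`. -/
def IndepMod (p : ℕ) (v w : Fin 4 → ℤ) : Prop :=
  ∃ i j, ¬ (p : ℤ) ∣ v i * w j - v j * w i

theorem IndepMod.congr {p : ℕ} {v v' : Fin 4 → ℤ} (M : Matrix (Fin 4) (Fin 4) ℤ)
    (h : IndepMod p v (M.mulVec v)) (hv : ∀ i, (p : ℤ) ∣ v' i - v i) :
    IndepMod p v' (M.mulVec v') := by
  obtain ⟨i, j, hij⟩ := h
  have hM : ∀ i, (p : ℤ) ∣ M.mulVec v' i - M.mulVec v i := by
    intro i
    simp only [Matrix.mulVec, dotProduct, ← Finset.sum_sub_distrib, ← mul_sub]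
    exact Finset.dvd_sum fun k _ => (hv k).mul_left _
  refine ⟨i, j, fun H => hij ?_⟩
  obtain ⟨a, ha⟩ := hv i
  obtain ⟨b, hb⟩ := hv j
  obtain ⟨c, hc⟩ := hM i
  obtain ⟨d, hd⟩ := hM j
  obtain ⟨k, hk⟩ := H
  refine ⟨k - a * M.mulVec v' j - v i * d + b * M.mulVec v' i + v j * c, ?_⟩
  linear_combination hk - M.mulVec v' j * ha - v i * hd + M.mulVec v' i * hb + v j * hc

open Matrix in
/-- A `2 × 4` integer matrix whose minors have no common prime factor admits a linear form
that kills the first row and takes the value `1` on the second one. -/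
theorem exists_form_of_minors (v w : Fin 4 → ℤ)
    (hm : ∀ p : ℕ, p.Prime → IndepMod p v w) :
    ∃ l : Fin 4 → ℤ, l ⬝ᵥ v = 0 ∧ l ⬝ᵥ w = 1 := by
  have htop : Ideal.span (Set.range fun k : Fin 4 × Fin 4 => v k.1 * w k.2 - v k.2 * w k.1) = ⊤ := by
    by_contra hne
    obtain ⟨M, hM, hle⟩ := Ideal.exists_le_maximal _ hne
    obtain ⟨d, hd⟩ := IsPrincipalIdealRing.principal M
    change M = Ideal.span {d} at hd
    have hd1 : d.natAbs ≠ 1 := by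
      intro h1
      apply hM.ne_top
      rw [hd, Ideal.span_singleton_eq_top]
      exact Int.isUnit_iff_natAbs_eq.mpr h1
    obtain ⟨p, hp, hpd⟩ := Nat.exists_prime_and_dvd hd1
    obtain ⟨i, j, hij⟩ := hm p hp
    apply hij
    have : v i * w j - v j * w i ∈ M := hle (Ideal.subset_span ⟨(i, j), rfl⟩)
    rw [hd, Ideal.mem_span_singleton] at this
    exact (Int.natCast_dvd.mpr hpd).trans this
  have h1 : (1 : ℤ) ∈ Ideal.span
      (Set.range fun k : Fin 4 × Fin 4 => v k.1 * w k.2 - v k.2 * w k.1) := by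
    rw [htop]; trivial
  obtain ⟨c, hc⟩ := Ideal.mem_span_range_iff_exists_fun.mp h1
  simp only [Fintype.sum_prod_type, Fin.sum_univ_four] at hc
  refine ⟨fun j => ∑ i, (c (i, j) - c (j, i)) * v i, ?_, ?_⟩
  · simp only [dotProduct, Fin.sum_univ_four]; ring
  · simp only [dotProduct, Fin.sum_univ_four]
    linear_combination hc

theorem exists_not_dvd_quadratic {p : ℕ} {a b c : ℤ}
    (h : ¬ ((p : ℤ) ∣ a ∧ (p : ℤ) ∣ b ∧ (p : ℤ) ∣ c)) :
    ∃ x y : ℤ, ¬ (p : ℤ) ∣ a * x ^ 2 - b * x * y + c * y ^ 2 := by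
  by_contra! H
  have h1 := H 1 0
  have h2 := H 0 1
  have h3 := H 1 1
  norm_num at h1 h2 h3
  refine h ⟨h1, ?_, h2⟩
  have : b = a + c - (a - b + c) := by ring
  rw [this]
  exact dvd_sub (dvd_add h1 h2) h3

/-- The matrix, in the basis `(τ₂, 0), (1, 0), (z, τ₁), (0, 1)`, of a multiplication that has
blocks `g₂ * (a₂ τ₂) + e` and `g₁ * (a₁ τ₁)` on the diagonal, where `aᵢ τᵢ² + bᵢ τᵢ + cᵢ = 0`. -/
def actionMatrix (a₁ b₁ c₁ a₂ b₂ c₂ g₁ g₂ e r s r' s' : ℤ) : Matrix (Fin 4) (Fin 4) ℤ :=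
  !![e - g₂ * b₂, g₂ * a₂, r', r;
     -(g₂ * c₂), e, s', s;
     0, 0, -(g₁ * b₁), g₁ * a₁;
     0, 0, -(g₁ * c₁), 0]

section

variable {a₁ b₁ c₁ a₂ b₂ c₂ g₁ g₂ e r s r' s' : ℤ}

theorem actionMatrix_mulVec (y x α β : ℤ) :
    (actionMatrix a₁ b₁ c₁ a₂ b₂ c₂ g₁ g₂ e r s r' s').mulVec ![y, x, α, β] =
      ![(e - g₂ * b₂) * y + g₂ * a₂ * x + r' * α + r * β,
        -(g₂ * c₂) * y + e * x + s' * α + s * β,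
        -(g₁ * b₁) * α + g₁ * a₁ * β,
        -(g₁ * c₁) * α] := by
  ext i
  fin_cases i <;> simp [actionMatrix, Matrix.mulVec, dotProduct, Fin.sum_univ_four]

theorem exists_indepMod_of_dvd {p : ℕ} (hp : p.Prime)
    (h₁ : ¬ ((p : ℤ) ∣ a₁ ∧ (p : ℤ) ∣ b₁ ∧ (p : ℤ) ∣ c₁))
    (hR : (p : ℤ) ∣ g₁ → (p : ℤ) ∣ g₂ →
      ¬ ((p : ℤ) ∣ r ∧ (p : ℤ) ∣ s ∧ (p : ℤ) ∣ r' ∧ (p : ℤ) ∣ s')) (hpg : (p : ℤ) ∣ g₂) :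
    ∃ α β : ℤ, IndepMod p ![0, 0, α, β]
      ((actionMatrix a₁ b₁ c₁ a₂ b₂ c₂ g₁ g₂ e r s r' s').mulVec ![0, 0, α, β]) := by
  have hpp := Nat.prime_iff_prime_int.mp hp
  simp only [actionMatrix_mulVec]
  by_cases hpg₁ : (p : ℤ) ∣ g₁
  · by_contra! H
    have h10 := H 1 0
    have h01 := H 0 1
    simp only [IndepMod, not_exists, not_not] at h10 h01
    refine hR hpg₁ hpg ⟨?_, ?_, ?_, ?_⟩
    · simpa using h01 0 3
    · simpa using h01 1 3
    · simpa using h10 0 2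
    · simpa using h10 1 2
  · obtain ⟨x, y, hxy⟩ := exists_not_dvd_quadratic h₁
    refine ⟨y, x, 2, 3, fun h => ?_⟩
    simp only [Matrix.cons_val] at h
    have h' : (p : ℤ) ∣ g₁ * (a₁ * x ^ 2 - b₁ * x * y + c₁ * y ^ 2) := by
      exact (dvd_neg.mpr h).trans (Eq.dvd (by ring))
    exact (hpp.dvd_or_dvd h').elim hpg₁ hxy

theorem exists_indepMod_of_not_dvd {p : ℕ} (hp : p.Prime)
    (h₂ : ¬ ((p : ℤ) ∣ a₂ ∧ (p : ℤ) ∣ b₂ ∧ (p : ℤ) ∣ c₂)) (hpg : ¬ (p : ℤ) ∣ g₂) (α β : ℤ) :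
    ∃ y x : ℤ, IndepMod p ![y, x, α, β]
      ((actionMatrix a₁ b₁ c₁ a₂ b₂ c₂ g₁ g₂ e r s r' s').mulVec ![y, x, α, β]) := by
  have hpp := Nat.prime_iff_prime_int.mp hp
  simp only [actionMatrix_mulVec]
  by_contra! H
  simp only [IndepMod, not_exists, not_not] at H
  -- differences of minors linear in `(y, x)`
  have lin : ∀ k : Fin 4, k = 2 ∨ k = 3 → ¬ (p : ℤ) ∣ (![0, 0, α, β] : Fin 4 → ℤ) k → False := by
    intro k hk hnd
    obtain ⟨γ, hγ⟩ : ∃ γ, γ = (![0, 0, α, β] : Fin 4 → ℤ) k := ⟨_, rfl⟩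
    rw [← hγ] at hnd
    obtain ⟨μ, hμ⟩ : ∃ μ, μ = (![0, 0, -(g₁ * b₁) * α + g₁ * a₁ * β, -(g₁ * c₁) * α]
      : Fin 4 → ℤ) k := ⟨_, rfl⟩
    have A : ∀ y x : ℤ, (p : ℤ) ∣
        y * μ - γ * ((e - g₂ * b₂) * y + g₂ * a₂ * x + r' * α + r * β) := by
      intro y x
      have := H y x 0 k
      rcases hk with rfl | rfl <;> simpa [hγ, hμ] using this
    have B : ∀ y x : ℤ, (p : ℤ) ∣
        x * μ - γ * (-(g₂ * c₂) * y + e * x + s' * α + s * β) := by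
      intro y x
      have := H y x 1 k
      rcases hk with rfl | rfl <;> simpa [hγ, hμ] using this
    have hcancel : ∀ t : ℤ, (p : ℤ) ∣ γ * (g₂ * t) → (p : ℤ) ∣ t := fun t ht =>
      ((hpp.dvd_or_dvd ht).resolve_left hnd |> hpp.dvd_or_dvd).resolve_left hpg
    refine h₂ ⟨hcancel _ ?_, hcancel _ ?_, hcancel _ ?_⟩
    · exact (dvd_sub (A 0 0) (A 0 1)).trans (Eq.dvd (by ring))
    · exact (dvd_sub (dvd_sub (A 1 0) (A 0 0)) (dvd_sub (B 0 1) (B 0 0))).trans (Eq.dvd (by ring))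
    · exact (dvd_sub (B 1 0) (B 0 0)).trans (Eq.dvd (by ring))
  have hα : (p : ℤ) ∣ α := by
    by_contra h
    exact lin 2 (Or.inl rfl) h
  have hβ : (p : ℤ) ∣ β := by
    by_contra h
    exact lin 3 (Or.inr rfl) h
  obtain ⟨x, y, hxy⟩ := exists_not_dvd_quadratic h₂
  have h := H y x 0 1
  simp only [Matrix.cons_val] at h
  have h' : (p : ℤ) ∣ g₂ * (a₂ * x ^ 2 - b₂ * x * y + c₂ * y ^ 2) := by
    obtain ⟨k, hk⟩ := h
    obtain ⟨i, hi⟩ := hα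
    obtain ⟨j, hj⟩ := hβ
    refine ⟨-k + y * (s' * i + s * j) - x * (r' * i + r * j), ?_⟩
    linear_combination -hk + (y * s' - x * r') * hi + (y * s - x * r) * hj
  exact (hpp.dvd_or_dvd h').elim hpg hxy

theorem exists_cyclic_vector
    (hg₁ : g₁ ≠ 0) (hg₂ : g₂ ≠ 0)
    (h₁ : ∀ p : ℕ, p.Prime → ¬ ((p : ℤ) ∣ a₁ ∧ (p : ℤ) ∣ b₁ ∧ (p : ℤ) ∣ c₁))
    (h₂ : ∀ p : ℕ, p.Prime → ¬ ((p : ℤ) ∣ a₂ ∧ (p : ℤ) ∣ b₂ ∧ (p : ℤ) ∣ c₂))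
    (hQ : ∀ x y : ℤ, a₁ * x ^ 2 - b₁ * x * y + c₁ * y ^ 2 = 0 → x = 0 ∧ y = 0)
    (hR : ∀ p : ℕ, p.Prime → (p : ℤ) ∣ g₁ → (p : ℤ) ∣ g₂ →
      ¬ ((p : ℤ) ∣ r ∧ (p : ℤ) ∣ s ∧ (p : ℤ) ∣ r' ∧ (p : ℤ) ∣ s')) :
    ∃ v l : Fin 4 → ℤ, dotProduct l v = 0 ∧
      dotProduct l ((actionMatrix a₁ b₁ c₁ a₂ b₂ c₂ g₁ g₂ e r s r' s').mulVec v) = 1 := by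
  have key : ∀ p : ℕ, ∃ k : ℤ × ℤ, p.Prime → (p : ℤ) ∣ g₂ → IndepMod p ![0, 0, k.1, k.2]
      ((actionMatrix a₁ b₁ c₁ a₂ b₂ c₂ g₁ g₂ e r s r' s').mulVec ![0, 0, k.1, k.2]) := by
    intro p
    by_cases hp : p.Prime ∧ (p : ℤ) ∣ g₂
    · obtain ⟨α, β, h⟩ := exists_indepMod_of_dvd (a₂ := a₂) (b₂ := b₂) (c₂ := c₂) (e := e)
        hp.1 (h₁ p hp.1) (hR p hp.1) hp.2
      exact ⟨(α, β), fun _ _ => h⟩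
    · exact ⟨0, fun h h' => absurd ⟨h, h'⟩ hp⟩
  choose k hk using key
  have memS : ∀ {m : ℤ} {p : ℕ}, m ≠ 0 → p.Prime → (p : ℤ) ∣ m → p ∈ m.natAbs.primeFactors :=
    fun hm hp h => Nat.mem_primeFactors.mpr ⟨hp, Int.natCast_dvd.mp h, Int.natAbs_ne_zero.mpr hm⟩
  have hS : ∀ m : ℤ, ∀ p ∈ m.natAbs.primeFactors, p.Prime :=
    fun m p hp => Nat.prime_of_mem_primeFactors hp
  obtain ⟨α, β, hαβ, h0⟩ : ∃ α β : ℤ, (∀ p : ℕ, p.Prime → (p : ℤ) ∣ g₂ →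
      IndepMod p ![0, 0, α, β]
        ((actionMatrix a₁ b₁ c₁ a₂ b₂ c₂ g₁ g₂ e r s r' s').mulVec ![0, 0, α, β])) ∧
      ¬ (β = 0 ∧ α = 0) := by
    obtain ⟨α, hα⟩ := exists_int_modEq_of_primes _ (hS g₂) (fun p => (k p).1)
    obtain ⟨β, hβ⟩ := exists_int_modEq_of_primes _ (hS g₂) (fun p => (k p).2)
    refine ⟨if α = 0 then g₂ else α, β, fun p hp hpg => ?_, ?_⟩
    · refine (hk p hp hpg).congr _ fun i => ?_
      have ha := hα p (memS hg₂ hp hpg)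
      have hb := hβ p (memS hg₂ hp hpg)
      fin_cases i
      · simp
      · simp
      · change (p : ℤ) ∣ (if α = 0 then g₂ else α) - (k p).1
        split_ifs with h
        · rw [h, zero_sub, dvd_neg] at ha
          exact dvd_sub hpg ha
        · exact ha
      · exact hb
    · rintro ⟨-, h⟩
      split_ifs at h <;> contradiction
  set N := g₁ * (a₁ * β ^ 2 - b₁ * β * α + c₁ * α ^ 2) * g₂ with hN
  have hN0 : N ≠ 0 := mul_ne_zero (mul_ne_zero hg₁ fun h => h0 (hQ _ _ h)) hg₂
  have key' : ∀ p : ℕ, ∃ m : ℤ × ℤ, p.Prime → IndepMod p ![m.1, m.2, α, β]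
      ((actionMatrix a₁ b₁ c₁ a₂ b₂ c₂ g₁ g₂ e r s r' s').mulVec ![m.1, m.2, α, β]) := by
    intro p
    by_cases hp : p.Prime
    swap
    · exact ⟨0, fun h => absurd h hp⟩
    by_cases hpg : (p : ℤ) ∣ g₂
    · exact ⟨0, fun _ => hαβ p hp hpg⟩
    · obtain ⟨y, x, h⟩ := exists_indepMod_of_not_dvd (a₁ := a₁) (b₁ := b₁) (c₁ := c₁)
        (g₁ := g₁) (e := e) (r := r) (s := s) (r' := r') (s' := s') hp (h₂ p hp) hpg α β
      exact ⟨(y, x), fun _ => h⟩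
  choose m hm using key'
  obtain ⟨y, hy⟩ := exists_int_modEq_of_primes _ (hS N) (fun p => (m p).1)
  obtain ⟨x, hx⟩ := exists_int_modEq_of_primes _ (hS N) (fun p => (m p).2)
  refine ⟨![y, x, α, β], exists_form_of_minors _ _ fun p hp => ?_⟩
  by_cases hpN : (p : ℤ) ∣ N
  · refine (hm p hp).congr _ fun i => ?_
    fin_cases i
    · exact hy p (memS hN0 hp hpN)
    · exact hx p (memS hN0 hp hpN)
    · simp
    · simp
  · rw [actionMatrix_mulVec]
    refine ⟨2, 3, fun h => hpN ?_⟩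
    simp only [Matrix.cons_val] at h
    refine Dvd.dvd.mul_right ?_ _
    exact (dvd_neg.mpr h).trans (Eq.dvd (by ring))

end

section

variable {F : Type*} [Field F]

/-- `a τ² + b τ + c = 0` is a primitive integral equation for `τ`. -/
structure IsPrimEq (τ : F) (a b c : ℤ) : Prop where
  ne_zero : a ≠ 0
  bezout : ∃ u v w : ℤ, u * a + v * b + w * c = 1
  eq_zero : a * τ ^ 2 + b * τ + c = 0

theorem IsPrimEq.neg {τ : F} {a b c : ℤ} (h : IsPrimEq τ a b c) :
    IsPrimEq τ (-a) (-b) (-c) := by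
  obtain ⟨h0, ⟨u, v, w, h1⟩, h2⟩ := h
  refine ⟨neg_ne_zero.mpr h0, ⟨-u, -v, -w, by linear_combination h1⟩, ?_⟩
  push_cast
  linear_combination -h2

theorem IsPrimEq.not_dvd {τ : F} {a b c : ℤ} (h : IsPrimEq τ a b c) (p : ℕ) (hp : p.Prime) :
    ¬ ((p : ℤ) ∣ a ∧ (p : ℤ) ∣ b ∧ (p : ℤ) ∣ c) := by
  rintro ⟨ha, hb, hc⟩
  obtain ⟨u, v, w, h1⟩ := h.bezout
  refine (Nat.prime_iff_prime_int.mp hp).not_isUnit (isUnit_of_dvd_one ?_)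
  rw [← h1]
  exact dvd_add (dvd_add (ha.mul_left u) (hb.mul_left v)) (hc.mul_left w)

theorem mem_span_one_pair {τ x : F} :
    x ∈ Submodule.span ℤ {1, τ} ↔ ∃ m k : ℤ, x = m + k * τ := by
  simp only [Submodule.mem_span_pair, zsmul_eq_mul, mul_one, eq_comm]

open Pointwise in
theorem mem_mul_span_iff {τ₁ τ₂ x : F} :
    x ∈ Submodule.span ℤ {1, τ₁} * Submodule.span ℤ {1, τ₂} ↔
      ∃ A B C D : ℤ, x = A + B * τ₁ + C * τ₂ + D * (τ₁ * τ₂) := by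
  rw [Submodule.span_mul_span]
  have : ({1, τ₁} : Set F) * ({1, τ₂} : Set F) = {1, τ₁, τ₂, τ₁ * τ₂} := by
    ext y
    simp only [Set.mem_mul, Set.mem_insert_iff, Set.mem_singleton_iff, exists_eq_or_imp,
      exists_eq_left, one_mul, mul_one, eq_comm (b := y)]
    tauto
  rw [this]
  simp only [Submodule.mem_span_insert, Submodule.mem_span_singleton, zsmul_eq_mul, mul_one]
  constructor
  · rintro ⟨A, _, ⟨B, _, ⟨C, _, ⟨D, rfl⟩, rfl⟩, rfl⟩, rfl⟩
    exact ⟨A, B, C, D, by ring⟩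
  · rintro ⟨A, B, C, D, rfl⟩
    exact ⟨A, _, ⟨B, _, ⟨C, _, ⟨D, rfl⟩, rfl⟩, rfl⟩, by ring⟩

end

section

variable {K}

theorem exists_rat_coords (hdeg : Module.finrank ℚ K = 2) {τ : K}
    (hτ : τ ∉ (algebraMap ℚ K).range) (x : K) : ∃ q r : ℚ, x = q + r * τ := by
  have hli : LinearIndependent ℚ ![(1 : K), τ] := by
    rw [LinearIndependent.pair_iff' one_ne_zero]
    intro a h
    exact hτ ⟨a, by rw [← h, Algebra.smul_def, mul_one]⟩
  have hspan := hli.span_eq_top_of_card_eq_finrank (by simp [hdeg])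
  have hx : x ∈ Submodule.span ℚ (Set.range ![(1 : K), τ]) := by rw [hspan]; trivial
  rw [Matrix.range_cons, Matrix.range_cons, Matrix.range_empty, Set.union_empty,
    Set.singleton_union, Submodule.mem_span_pair] at hx
  obtain ⟨a, b, h⟩ := hx
  refine ⟨a, b, ?_⟩
  rw [← h, Rat.smul_def, Rat.smul_def, mul_one]

theorem int_coords_eq_zero {τ : K} (hτ : τ ∉ (algebraMap ℚ K).range) {m k : ℤ}
    (h : (m : K) + k * τ = 0) : m = 0 ∧ k = 0 := by
  have hk : k = 0 := by
    by_contra hk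
    have hk' : (k : K) ≠ 0 := Int.cast_ne_zero.mpr hk
    refine hτ ⟨-m / k, ?_⟩
    simp only [map_div₀, map_neg, map_intCast]
    rw [div_eq_iff hk']
    linear_combination -h
  subst hk
  simpa using h

theorem exists_int_mul_mem (hdeg : Module.finrank ℚ K = 2) {τ : K}
    (hτ : τ ∉ (algebraMap ℚ K).range) (x : K) :
    ∃ d m k : ℤ, 0 < d ∧ d * x = m + k * τ := by
  obtain ⟨q, r, h⟩ := exists_rat_coords hdeg hτ x
  refine ⟨q.den * r.den, q.num * r.den, r.num * q.den, ?_, ?_⟩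
  · have := q.den_pos
    have := r.den_pos
    positivity
  · have hq : (q : K) * q.den = q.num := by exact_mod_cast congrArg (Rat.cast (K := K)) q.mul_den_eq_num
    have hr : (r : K) * r.den = r.num := by exact_mod_cast congrArg (Rat.cast (K := K)) r.mul_den_eq_num
    rw [h]
    push_cast
    linear_combination (r.den : K) * hq + (q.den : K) * τ * hr

theorem exists_isPrimEq (hdeg : Module.finrank ℚ K = 2) {τ : K}
    (hτ : τ ∉ (algebraMap ℚ K).range) : ∃ a b c : ℤ, IsPrimEq τ a b c := by
  obtain ⟨d, m, k, hd, h⟩ := exists_int_mul_mem hdeg hτ (τ ^ 2)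
  obtain ⟨g, hg⟩ := IsPrincipalIdealRing.principal (Ideal.span {d, k, m})
  change _ = Ideal.span {g} at hg
  have hdiv : ∀ x ∈ ({d, k, m} : Set ℤ), g ∣ x := fun x hx => by
    rw [← Ideal.mem_span_singleton, ← hg]
    exact Ideal.subset_span hx
  obtain ⟨a, ha⟩ := hdiv d (by simp)
  obtain ⟨b, hb⟩ := hdiv k (by simp)
  obtain ⟨c, hc⟩ := hdiv m (by simp)
  have hg0 : g ≠ 0 := by rintro rfl; simp at ha; omega
  have hgm : g ∈ Ideal.span {d, k, m} := by rw [hg]; exact Ideal.mem_span_singleton_self g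
  obtain ⟨u, y, hy, hu⟩ := Submodule.mem_span_insert.mp hgm
  obtain ⟨v, w, hv⟩ := Submodule.mem_span_pair.mp hy
  refine ⟨a, -b, -c, ⟨?_, ⟨u, -v, -w, ?_⟩, ?_⟩⟩
  · rintro rfl; simp at ha; omega
  · apply mul_left_cancel₀ hg0
    simp only [smul_eq_mul] at hu hv
    linear_combination -hu + hv - u * ha - v * hb - w * hc
  · apply mul_left_cancel₀ (Int.cast_ne_zero (α := K).mpr hg0)
    have ha' : (d : K) = g * a := by exact_mod_cast ha
    have hb' : (k : K) = g * b := by exact_mod_cast hb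
    have hc' : (m : K) = g * c := by exact_mod_cast hc
    push_cast
    linear_combination h - τ ^ 2 * ha' + τ * hb' + hc'

theorem mem_multLat_iff {τ : K} (hτ : τ ∉ (algebraMap ℚ K).range) {a b c : ℤ}
    (h : IsPrimEq τ a b c) (x : K) :
    x ∈ multLat K (Submodule.span ℤ {1, τ}) ↔ ∃ m k : ℤ, x = m + k * (a * τ) := by
  constructor
  · intro hx
    obtain ⟨m, l, hm⟩ := mem_span_one_pair.mp (hx 1 (mem_span_one_pair.mpr ⟨1, 0, by simp⟩))
    obtain ⟨i, j, hi⟩ := mem_span_one_pair.mp (hx τ (mem_span_one_pair.mpr ⟨0, 1, by simp⟩))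
    rw [mul_one] at hm
    obtain ⟨e1, e2⟩ := int_coords_eq_zero (m := a * i + l * c) (k := a * j - a * m + l * b) hτ (by
      push_cast
      linear_combination l * h.eq_zero - a * hi + a * τ * hm)
    obtain ⟨u, v, w, h1⟩ := h.bezout
    refine ⟨m, u * l - v * (j - m) - w * i, ?_⟩
    have hl : l = (u * l - v * (j - m) - w * i) * a := by
      linear_combination -l * h1 + v * e2 + w * e1
    rw [hm]
    nth_rw 1 [hl]
    push_cast
    ring
  · rintro ⟨m, k, rfl⟩ y hy
    obtain ⟨i, j, rfl⟩ := mem_span_one_pair.mp hy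
    refine mem_span_one_pair.mpr ⟨m * i - k * j * c, m * j + k * a * i - k * j * b, ?_⟩
    push_cast
    linear_combination k * j * h.eq_zero

theorem mem_orderSet_iff {τ : K} (hτ : τ ∉ (algebraMap ℚ K).range) {a b c : ℤ}
    (h : IsPrimEq τ a b c) {f : ℕ} (hf : HasCond K (Submodule.span ℤ {1, τ}) f) (g : ℕ) (x : K) :
    x ∈ orderSet K (g * f) ↔ ∃ m k : ℤ, x = m + k * (g * a * τ) := by
  have key : ∀ y, y ∈ orderSet K f ↔ ∃ m k : ℤ, y = m + k * (a * τ) := fun y => by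
    rw [← hf.2]; exact mem_multLat_iff hτ h y
  constructor
  · rintro ⟨m, y, rfl⟩
    obtain ⟨i, k, hy⟩ := (key (f * algebraMap _ K y)).mp ⟨0, y, by simp⟩
    refine ⟨m + g * i, k, ?_⟩
    push_cast
    linear_combination g * hy
  · rintro ⟨m, k, rfl⟩
    obtain ⟨i, y, hy⟩ := (key (a * τ)).mpr ⟨0, 1, by simp⟩
    refine ⟨m + k * g * i, k • y, ?_⟩
    rw [map_zsmul, zsmul_eq_mul]
    push_cast
    linear_combination k * g * hy

/-- Two generators of the same order differ by an integer, up to the sign of one of them. -/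
theorem exists_generator_eq {τ₁ τ₂ : K} (hτ₁ : τ₁ ∉ (algebraMap ℚ K).range)
    (hτ₂ : τ₂ ∉ (algebraMap ℚ K).range) {a₁ b₁ c₁ a₂ b₂ c₂ : ℤ} (h₁ : IsPrimEq τ₁ a₁ b₁ c₁)
    (h₂ : IsPrimEq τ₂ a₂ b₂ c₂) {f₁ f₂ g₁ g₂ : ℕ} (hf₁ : HasCond K (Submodule.span ℤ {1, τ₁}) f₁)
    (hf₂ : HasCond K (Submodule.span ℤ {1, τ₂}) f₂) (hg : g₁ * f₁ = g₂ * f₂) (hg₁ : 0 < g₁) :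
    ∃ e k : ℤ, (k = 1 ∨ k = -1) ∧ g₁ * a₁ * τ₁ = e + k * (g₂ * a₂ * τ₂) := by
  obtain ⟨e, k, he⟩ := (mem_orderSet_iff hτ₂ h₂ hf₂ g₂ _).mp
    (hg ▸ (mem_orderSet_iff hτ₁ h₁ hf₁ g₁ (g₁ * a₁ * τ₁)).mpr ⟨0, 1, by simp⟩)
  obtain ⟨e', k', he'⟩ := (mem_orderSet_iff hτ₁ h₁ hf₁ g₁ _).mp
    (hg ▸ (mem_orderSet_iff hτ₂ h₂ hf₂ g₂ (g₂ * a₂ * τ₂)).mpr ⟨0, 1, by simp⟩)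
  refine ⟨e, k, ?_, he⟩
  obtain ⟨-, hkk⟩ := int_coords_eq_zero (m := e + k * e') (k := (k * k' - 1) * (g₁ * a₁)) hτ₁ (by
    push_cast
    linear_combination -he - k * he')
  have : k * k' = 1 := by
    have hne : (g₁ : ℤ) * a₁ ≠ 0 := mul_ne_zero (by exact_mod_cast hg₁.ne') h₁.ne_zero
    linear_combination (mul_eq_zero.mp hkk).resolve_right hne
  exact Int.isUnit_iff.mp (IsUnit.of_mul_eq_one _ this)

end

section

variable {K}

section

variable {τ₁ τ₂ : K} {a₁ b₁ c₁ a₂ b₂ c₂ g₁ g₂ e : ℤ}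

/-- Comparison of the minimal equations of `g₁ a₁ τ₁` and `e + g₂ a₂ τ₂`. -/
theorem trace_norm_eq (hτ₂ : τ₂ ∉ (algebraMap ℚ K).range) (h₁ : IsPrimEq τ₁ a₁ b₁ c₁)
    (h₂ : IsPrimEq τ₂ a₂ b₂ c₂) (hg₂ : g₂ ≠ 0) (hω : (g₁ * a₁ * τ₁ : K) = e + g₂ * a₂ * τ₂) :
    g₂ * b₂ = g₁ * b₁ + 2 * e ∧
      g₁ ^ 2 * a₁ * c₁ + e * (g₁ * b₁) + e ^ 2 = g₂ ^ 2 * a₂ * c₂ := by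
  obtain ⟨e1, e2⟩ := int_coords_eq_zero
    (m := g₁ ^ 2 * a₁ * c₁ + e * (g₁ * b₁) + e ^ 2 - g₂ ^ 2 * a₂ * c₂)
    (k := (2 * e + g₁ * b₁ - g₂ * b₂) * (g₂ * a₂)) hτ₂ (by
      push_cast
      linear_combination g₁ ^ 2 * a₁ * h₁.eq_zero - g₂ ^ 2 * a₂ * h₂.eq_zero
        - (g₁ * a₁ * τ₁ + e + g₂ * a₂ * τ₂ + g₁ * b₁) * hω)
  have h := (mul_eq_zero.mp e2).resolve_right (mul_ne_zero hg₂ h₂.ne_zero)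
  exact ⟨by linear_combination -h, by linear_combination e1⟩

/-- If multiplication by `g₁` and by `g₁ a₁ τ₁` maps `x` into `ℤ + ℤ τ₂`, then `x` lies in
`(ℤ + ℤ a₁ τ₁) (ℤ + ℤ τ₂)`. -/
theorem exists_coords_of_mul_mem (hτ₂ : τ₂ ∉ (algebraMap ℚ K).range)
    (h₁ : IsPrimEq τ₁ a₁ b₁ c₁) (h₂ : IsPrimEq τ₂ a₂ b₂ c₂) (hg₁ : g₁ ≠ 0) (hg₂ : g₂ ≠ 0)
    (hg : IsCoprime g₁ g₂) (hω : (g₁ * a₁ * τ₁ : K) = e + g₂ * a₂ * τ₂) {x : K} {u v u' v' : ℤ}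
    (hx : g₁ * x = u + v * τ₂) (hx' : g₁ * a₁ * τ₁ * x = u' + v' * τ₂) :
    ∃ i j k l : ℤ, x = i + j * τ₂ + a₁ * τ₁ * (k + l * τ₂) := by
  obtain ⟨T, -⟩ := trace_norm_eq hτ₂ h₁ h₂ hg₂ hω
  obtain ⟨D1, D2⟩ := int_coords_eq_zero (m := g₁ * u' - (e * u - g₂ * c₂ * v))
    (k := g₁ * v' - (e * v + g₂ * a₂ * u - g₂ * b₂ * v)) hτ₂ (by
      push_cast
      linear_combination -g₁ * hx' + g₁ * a₁ * τ₁ * hx + (u + v * τ₂) * hω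
        + g₂ * v * h₂.eq_zero)
  have T' : (g₂ * b₂ : K) = g₁ * b₁ + 2 * e := by exact_mod_cast T
  have D1' : (g₁ * u' - (e * u - g₂ * c₂ * v) : K) = 0 := by exact_mod_cast D1
  have D2' : (g₁ * v' - (e * v + g₂ * a₂ * u - g₂ * b₂ * v) : K) = 0 := by exact_mod_cast D2
  have hg₁' : (g₁ : K) ≠ 0 := Int.cast_ne_zero.mpr hg₁
  have A : g₂ * a₂ * x = v * (a₁ * τ₁) + v' + b₁ * v := by
    apply mul_left_cancel₀ hg₁'
    linear_combination g₂ * a₂ * hx - v * hω - D2' + v * T'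
  have B : e * x = u' - b₁ * v * τ₂ - v * (a₁ * τ₁) * τ₂ := by
    linear_combination hx' - x * hω - τ₂ * A
  have C : g₂ * c₂ * x = -u * (a₁ * τ₁) * τ₂ - (u' + b₁ * u) * τ₂ := by
    apply mul_left_cancel₀ hg₁'
    linear_combination g₂ * c₂ * hx + u * τ₂ * hω + τ₂ * D1' - u * τ₂ * T'
      + g₂ * u * h₂.eq_zero
  obtain ⟨s, t, hst⟩ := hg
  obtain ⟨U, V, W, hU⟩ := h₂.bezout
  have hst' : (s * g₁ + t * g₂ : K) = 1 := by exact_mod_cast hst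
  have hU' : (U * a₂ + V * b₂ + W * c₂ : K) = 1 := by exact_mod_cast hU
  refine ⟨s * u + t * (U * (v' + b₁ * v) + V * (b₁ * u + 2 * u')),
    s * v + t * (V * (b₁ * v - 2 * b₁ * v) - W * (u' + b₁ * u)),
    t * (U * v), t * (-2 * V * v - W * u), ?_⟩
  push_cast
  linear_combination -x * hst' - t * g₂ * x * hU' + s * hx + t * U * A
    + t * V * (x * T' + b₁ * hx + 2 * B) + t * W * C

theorem exists_coords_of_conj_mul_mem (hτ₂ : τ₂ ∉ (algebraMap ℚ K).range)
    (h₁ : IsPrimEq τ₁ a₁ b₁ c₁) (h₂ : IsPrimEq τ₂ a₂ b₂ c₂) (hg₁ : g₁ ≠ 0) (hg₂ : g₂ ≠ 0)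
    (hg : IsCoprime g₁ g₂) (hω : (g₁ * a₁ * τ₁ : K) = e + g₂ * a₂ * τ₂) {ζ : K} {u v u' v' : ℤ}
    (hζ : g₁ * a₁ * ζ = u + v * τ₂) (hζ' : g₁ * (a₁ * τ₁ + b₁) * ζ = u' + v' * τ₂) :
    ∃ A B C D : ℤ, ζ = A + B * τ₁ + C * τ₂ + D * (τ₁ * τ₂) := by
  obtain ⟨i, j, k, l, hx⟩ := exists_coords_of_mul_mem hτ₂ h₁ h₂ hg₁ hg₂ hg hω (x := a₁ * ζ)
    (u := u) (v := v) (u' := a₁ * u' - b₁ * u) (v' := a₁ * v' - b₁ * v)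
    (by linear_combination hζ) (by push_cast; linear_combination a₁ * hζ' - b₁ * hζ)
  obtain ⟨i', j', k', l', hy⟩ := exists_coords_of_mul_mem hτ₂ h₁ h₂ hg₁ hg₂ hg hω
    (x := (a₁ * τ₁ + b₁) * ζ) (u := u') (v := v') (u' := -c₁ * u) (v' := -c₁ * v)
    (by linear_combination hζ')
    (by push_cast; linear_combination -c₁ * hζ + g₁ * a₁ * ζ * h₁.eq_zero)
  obtain ⟨U, V, W, hU⟩ := h₁.bezout
  have hU' : (U * a₁ + V * b₁ + W * c₁ : K) = 1 := by exact_mod_cast hU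
  have E := h₁.eq_zero
  have hb : b₁ * ζ = i' + j' * τ₂ + a₁ * τ₁ * (k' + l' * τ₂)
      - (i * τ₁ + j * (τ₁ * τ₂) - (b₁ * τ₁ + c₁) * (k + l * τ₂)) := by
    linear_combination hy - τ₁ * hx - (k + l * τ₂) * E
  have hc : c₁ * ζ = -(i' * τ₁ + j' * (τ₁ * τ₂) - (b₁ * τ₁ + c₁) * (k' + l' * τ₂)) := by
    linear_combination -τ₁ * hy + (ζ - (k' + l' * τ₂)) * E
  refine ⟨U * i + V * (i' + c₁ * k) + W * (c₁ * k'),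
    U * (a₁ * k) + V * (a₁ * k' - i + b₁ * k) + W * (-i' + b₁ * k'),
    U * j + V * (j' + c₁ * l) + W * (c₁ * l'),
    U * (a₁ * l) + V * (a₁ * l' - j + b₁ * l) + W * (-j' + b₁ * l'), ?_⟩
  push_cast
  linear_combination -ζ * hU' + U * hx + V * hb + W * hc

/-- The `K`-linear form on `K²` attached to an integral linear form `l` on the lattice spanned by
`(τ₂, 0), (1, 0), (z, τ₁), (0, 1)`. -/
theorem exists_linear_form (hτ₂ : τ₂ ∉ (algebraMap ℚ K).range)
    (h₁ : IsPrimEq τ₁ a₁ b₁ c₁) (h₂ : IsPrimEq τ₂ a₂ b₂ c₂) (hg₁ : g₁ ≠ 0) (hg₂ : g₂ ≠ 0)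
    (hω : (g₁ * a₁ * τ₁ : K) = e + g₂ * a₂ * τ₂) {z : K} {r s r' s' : ℤ}
    (hz : -(g₁ * a₁ * z) = r * τ₂ + s)
    (hz' : g₁ * (a₁ * τ₁ + b₁) * z = r' * τ₂ + s') (l₀ l₁ l₂ l₃ : ℤ) :
    ∃ p q : K,
      p * τ₂ = ((e - g₂ * b₂) * l₀ - g₂ * c₂ * l₁) + l₀ * (g₁ * a₁ * τ₁ + g₁ * b₁) ∧
      p = (g₂ * a₂ * l₀ + e * l₁) + l₁ * (g₁ * a₁ * τ₁ + g₁ * b₁) ∧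
      p * z + q * τ₁ = (r' * l₀ + s' * l₁ - g₁ * b₁ * l₂ - g₁ * c₁ * l₃) +
        l₂ * (g₁ * a₁ * τ₁ + g₁ * b₁) ∧
      q = (r * l₀ + s * l₁ + g₁ * a₁ * l₂) + l₃ * (g₁ * a₁ * τ₁ + g₁ * b₁) := by
  obtain ⟨T, N⟩ := trace_norm_eq hτ₂ h₁ h₂ hg₂ hω
  have T' : (g₂ * b₂ : K) = g₁ * b₁ + 2 * e := by exact_mod_cast T
  have N' : (g₁ ^ 2 * a₁ * c₁ + e * (g₁ * b₁) + e ^ 2 : K) = g₂ ^ 2 * a₂ * c₂ := by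
    exact_mod_cast N
  obtain ⟨J1, J2⟩ := int_coords_eq_zero
    (m := e * s - g₂ * c₂ * r + g₁ * a₁ * s' + g₁ * b₁ * s)
    (k := e * r + g₂ * a₂ * s - g₂ * b₂ * r + g₁ * a₁ * r' + g₁ * b₁ * r) hτ₂ (by
      push_cast
      linear_combination -(r * τ₂ + s) * hω - (g₁ * a₁ * τ₁ + g₁ * b₁) * hz
        - g₁ * a₁ * hz' - g₂ * r * h₂.eq_zero)
  have J1' : (e * s - g₂ * c₂ * r + g₁ * a₁ * s' + g₁ * b₁ * s : K) = 0 := by exact_mod_cast J1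
  have J2' : (e * r + g₂ * a₂ * s - g₂ * b₂ * r + g₁ * a₁ * r' + g₁ * b₁ * r : K) = 0 := by
    exact_mod_cast J2
  have hk₁ : (g₁ * a₁ : K) ≠ 0 :=
    mul_ne_zero (Int.cast_ne_zero.mpr hg₁) (Int.cast_ne_zero.mpr h₁.ne_zero)
  have hk₂ : (g₂ * a₂ : K) ≠ 0 :=
    mul_ne_zero (Int.cast_ne_zero.mpr hg₂) (Int.cast_ne_zero.mpr h₂.ne_zero)
  have X1 : ((g₂ * a₂ * l₀ + e * l₁) + l₁ * (g₁ * a₁ * τ₁ + g₁ * b₁)) * τ₂ =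
      ((e - g₂ * b₂) * l₀ - g₂ * c₂ * l₁) + l₀ * (g₁ * a₁ * τ₁ + g₁ * b₁) := by
    apply mul_left_cancel₀ hk₂
    linear_combination -((g₂ * a₂ * l₀ + e * l₁) + l₁ * (g₁ * a₁ * τ₁ + g₁ * b₁)) * hω
      + l₀ * g₂ * a₂ * T' + l₁ * g₁ ^ 2 * a₁ * h₁.eq_zero - l₁ * N'
  refine ⟨_, _, X1, rfl, ?_, rfl⟩
  apply mul_left_cancel₀ hk₁
  linear_combination -((g₂ * a₂ * l₀ + e * l₁) + l₁ * (g₁ * a₁ * τ₁ + g₁ * b₁)) * hz - r * X1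
    + l₃ * g₁ ^ 2 * a₁ * h₁.eq_zero - l₁ * J1' - l₀ * J2'

end

end

section

variable {F : Type} [Field F]

theorem mem_span_period_iff {τ₁ τ₂ z : F} {l : Fin 2 → F} :
    l ∈ Submodule.span ℤ {![τ₂, 0], ![1, 0], ![z, τ₁], ![0, 1]} ↔
      ∃ A B C D : ℤ, l = ![A * τ₂ + B + C * z, C * τ₁ + D] := by
  simp only [Submodule.mem_span_insert, Submodule.mem_span_singleton]
  constructor
  · rintro ⟨A, _, ⟨B, _, ⟨C, _, ⟨D, rfl⟩, rfl⟩, rfl⟩, rfl⟩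
    refine ⟨A, B, C, D, ?_⟩
    ext i
    fin_cases i <;> simp [add_assoc]
  · rintro ⟨A, B, C, D, rfl⟩
    refine ⟨A, _, ⟨B, _, ⟨C, _, ⟨D, rfl⟩, rfl⟩, rfl⟩, ?_⟩
    ext i
    fin_cases i <;> simp [add_assoc]

/-- A lattice in `F²` stable under `O` that has a vector on which some linear form with values
in `O` takes the value `1` splits as `O` plus its lattice of determinants. -/
theorem exists_map_eq_latPair {τ₁ τ₂ z ω p q : F} {L : Submodule ℤ (Fin 2 → F)}
    {P O : Submodule ℤ F}
    (hL : ∀ l, l ∈ L ↔ ∃ A B C D : ℤ, l = ![A * τ₂ + B + C * z, C * τ₁ + D])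
    (hP : ∀ x, x ∈ P ↔ ∃ A B C D : ℤ, x = A + B * τ₁ + C * τ₂ + D * (τ₁ * τ₂))
    (hO : ∀ x, x ∈ O ↔ ∃ m k : ℤ, x = m + k * ω)
    (hωL : ∀ l ∈ L, ω • l ∈ L)
    (h₁ : p * τ₂ ∈ O) (h₂ : p ∈ O) (h₃ : p * z + q * τ₁ ∈ O) (h₄ : q ∈ O)
    {v : Fin 2 → F} (hv : v ∈ L) (hpq : p * v 0 + q * v 1 = 1) :
    ∃ γ : Matrix (Fin 2) (Fin 2) F, IsUnit γ ∧
      Submodule.map ((Matrix.mulVecLin γ).restrictScalars ℤ) L =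
        latPair F O (P ⊔ Submodule.span ℤ {z}) := by
  have hOL : ∀ x ∈ O, ∀ l ∈ L, x • l ∈ L := by
    intro x hx l hl
    obtain ⟨m, k, rfl⟩ := (hO x).mp hx
    have : ((m : F) + k * ω) • l = m • l + k • (ω • l) := by
      ext i; simp; ring
    rw [this]
    exact L.add_mem (L.smul_mem _ hl) (L.smul_mem _ (hωL l hl))
  have hφ : ∀ l ∈ L, p * l 0 + q * l 1 ∈ O := by
    intro l hl
    obtain ⟨A, B, C, D, rfl⟩ := (hL l).mp hl
    have : p * (![A * τ₂ + B + C * z, C * τ₁ + D] : Fin 2 → F) 0 +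
        q * (![A * τ₂ + B + C * z, C * τ₁ + D] : Fin 2 → F) 1 =
        A • (p * τ₂) + B • p + C • (p * z + q * τ₁) + D • q := by
      simp; ring
    rw [this]
    exact O.add_mem (O.add_mem (O.add_mem (O.smul_mem _ h₁) (O.smul_mem _ h₂))
      (O.smul_mem _ h₃)) (O.smul_mem _ h₄)
  set γ : Matrix (Fin 2) (Fin 2) F := !![p, q; -v 1, v 0] with hγ
  have hγ0 : ∀ l, (Matrix.mulVecLin γ).restrictScalars ℤ l =
      ![p * l 0 + q * l 1, -v 1 * l 0 + v 0 * l 1] := by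
    intro l
    ext i
    fin_cases i <;> simp [hγ, Matrix.mulVec, dotProduct, Fin.sum_univ_two]
  refine ⟨γ, ?_, ?_⟩
  · rw [Matrix.isUnit_iff_isUnit_det, hγ, Matrix.det_fin_two_of]
    rw [show p * v 0 - q * -v 1 = 1 by linear_combination hpq]
    exact isUnit_one
  apply le_antisymm
  · rintro _ ⟨l, hl, rfl⟩
    rw [hγ0]
    refine ⟨hφ l hl, ?_⟩
    obtain ⟨A, B, C, D, rfl⟩ := (hL l).mp hl
    obtain ⟨y, x, α, β, rfl⟩ := (hL v).mp hv
    refine Submodule.mem_sup.mpr ⟨_, (hP _).mpr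
      ⟨x * D - β * B, x * C - α * B, y * D - β * A, y * C - α * A, rfl⟩, _,
      Submodule.mem_span_singleton.mpr ⟨α * D - β * C, rfl⟩, ?_⟩
    simp
    ring
  · -- the image contains `0 ⊕ det(l, l')` for `l, l' ∈ L`
    have hdet : ∀ l ∈ L, ∀ l' ∈ L, ![0, l 0 * l' 1 - l 1 * l' 0] ∈
        Submodule.map ((Matrix.mulVecLin γ).restrictScalars ℤ) L := by
      intro l hl l' hl'
      refine ⟨(p * l 0 + q * l 1) • l' - (p * l' 0 + q * l' 1) • l,
        L.sub_mem (hOL _ (hφ l hl) _ hl') (hOL _ (hφ l' hl') _ hl), ?_⟩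
      rw [hγ0]
      ext i
      fin_cases i
      · simp
        ring
      · simp
        linear_combination (l 0 * l' 1 - l 1 * l' 0) * hpq
    have u₁ : ![τ₂, 0] ∈ L := (hL _).mpr ⟨1, 0, 0, 0, by simp⟩
    have u₂ : ![1, 0] ∈ L := (hL _).mpr ⟨0, 1, 0, 0, by simp⟩
    have u₃ : ![z, τ₁] ∈ L := (hL _).mpr ⟨0, 0, 1, 0, by simp⟩
    have u₄ : ![0, 1] ∈ L := (hL _).mpr ⟨0, 0, 0, 1, by simp⟩
    rintro m ⟨hm0, hm1⟩
    obtain ⟨t, ht, w, hw, htw⟩ := Submodule.mem_sup.mp hm1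
    obtain ⟨A, B, C, D, rfl⟩ := (hP t).mp ht
    obtain ⟨E, rfl⟩ := Submodule.mem_span_singleton.mp hw
    have hfst : ![m 0, 0] ∈ Submodule.map ((Matrix.mulVecLin γ).restrictScalars ℤ) L := by
      refine ⟨m 0 • v, hOL _ hm0 _ hv, ?_⟩
      rw [hγ0]
      ext i
      fin_cases i
      · simp
        linear_combination m 0 * hpq
      · simp
        ring
    have key : m = ![m 0, 0] + (A • ![0, 1] + B • ![0, τ₁] + C • ![0, τ₂] + D • ![0, τ₁ * τ₂]
        + E • ![0, z]) := by
      change A + B * τ₁ + C * τ₂ + D * (τ₁ * τ₂) + E • z = m 1 at htw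
      ext i
      fin_cases i
      · simp
      · simp [← htw]
    rw [key]
    refine Submodule.add_mem _ hfst (Submodule.add_mem _ (Submodule.add_mem _ (Submodule.add_mem _
      (Submodule.add_mem _ ?_ ?_) ?_) ?_) ?_) <;> refine Submodule.smul_mem _ _ ?_
    · simpa using hdet _ u₂ _ u₄
    · simpa using hdet _ u₂ _ u₃
    · simpa using hdet _ u₁ _ u₄
    · simpa [mul_comm] using hdet _ u₁ _ u₃
    · simpa using hdet _ u₃ _ u₄

end

section

variable {K}

theorem IsPrimEq.form_anisotropic {τ : K} (hτ : τ ∉ (algebraMap ℚ K).range) {a b c : ℤ}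
    (h : IsPrimEq τ a b c) (x y : ℤ) (hxy : a * x ^ 2 - b * x * y + c * y ^ 2 = 0) :
    x = 0 ∧ y = 0 := by
  have hxy' : (a * x ^ 2 - b * x * y + c * y ^ 2 : K) = 0 := by exact_mod_cast hxy
  have : (x + y * τ) * ((a * x - b * y : ℤ) + (-(a * y) : ℤ) * τ) = 0 := by
    push_cast
    linear_combination hxy' - y ^ 2 * h.eq_zero
  rcases mul_eq_zero.mp this with H | H
  · exact int_coords_eq_zero hτ H
  · obtain ⟨e1, e2⟩ := int_coords_eq_zero hτ H
    have hy : y = 0 := by simpa [h.ne_zero] using e2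
    subst hy
    exact ⟨by simpa [h.ne_zero] using e1, rfl⟩

end

/-- For `L₁ = ℤ + ℤτ₁`, `L₂ = ℤ + ℤτ₂` of conductors `f₁, f₂`, `f = lcm(f₁, f₂)`, and
`z ∈ K` whose class in `K/L₁L₂` has order `n`, the lattice spanned by the rows of the
period matrix `(τ₂ 1 z 0; 0 0 τ₁ 1)` is `GL₂(K)`-equivalent to `O_{nf} ⊕ (L₁L₂ + ℤz)`. -/
theorem period_lattice_canonical_form
    (hdeg : Module.finrank ℚ K = 2)
    (himag : IsEmpty (K →+* ℝ))
    (τ₁ τ₂ : K)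
    (hτ₁ : τ₁ ∉ (algebraMap ℚ K).range) (hτ₂ : τ₂ ∉ (algebraMap ℚ K).range)
    (L₁ L₂ : Submodule ℤ K)
    (hL₁ : L₁ = Submodule.span ℤ {1, τ₁}) (hL₂ : L₂ = Submodule.span ℤ {1, τ₂})
    (f₁ f₂ : ℕ) (hc₁ : HasCond K L₁ f₁) (hc₂ : HasCond K L₂ f₂)
    (f : ℕ) (hf : f = Nat.lcm f₁ f₂)
    (z : K) (n : ℕ)
    (hn : n = addOrderOf (Submodule.Quotient.mk z : K ⧸ (L₁ * L₂)))
    (L : Submodule ℤ (Fin 2 → K))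
    (hL : L = Submodule.span ℤ
      {![τ₂, 0], ![1, 0], ![z, τ₁], ![0, 1]}) :
    ∃ γ : Matrix (Fin 2) (Fin 2) K, IsUnit γ ∧
      Submodule.map ((Matrix.mulVecLin γ).restrictScalars ℤ) L =
        latPair K (orderLat K (n * f)) (L₁ * L₂ ⊔ Submodule.span ℤ {z}) := by
  subst hL₁ hL₂
  obtain ⟨a₁, b₁, c₁, h₁⟩ := exists_isPrimEq hdeg hτ₁
  -- cofactors of the conductors
  have hd : 0 < Nat.gcd f₁ f₂ := Nat.gcd_pos_of_pos_left _ hc₁.1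
  obtain ⟨g, k₂, k₁, hg, hcop, hk₂, hk₁⟩ := Nat.exists_coprime' hd
  have hk₁0 : 0 < k₁ := Nat.pos_of_ne_zero (by rintro rfl; have := hc₂.1; simp at hk₁; omega)
  have hk₂0 : 0 < k₂ := Nat.pos_of_ne_zero (by rintro rfl; have := hc₁.1; simp at hk₂; omega)
  have hf₁ : f = k₁ * f₁ := by
    rw [hf, hk₁, hk₂, Nat.lcm_mul_right, hcop.lcm_eq_mul]
    ring
  have hf₂ : k₁ * f₁ = k₂ * f₂ := by
    rw [hk₁, hk₂]
    ring
  obtain ⟨a₂, b₂, c₂, e, h₂, hω⟩ : ∃ a₂ b₂ c₂ e : ℤ, IsPrimEq τ₂ a₂ b₂ c₂ ∧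
      ((k₁ : ℤ) * a₁ * τ₁ : K) = e + (k₂ : ℤ) * a₂ * τ₂ := by
    obtain ⟨a₂, b₂, c₂, h₂⟩ := exists_isPrimEq hdeg hτ₂
    obtain ⟨e, k, rfl | rfl, h⟩ := exists_generator_eq hτ₁ hτ₂ h₁ h₂ hc₁ hc₂ hf₂ hk₁0
    · exact ⟨a₂, b₂, c₂, e, h₂, by push_cast at h ⊢; linear_combination h⟩
    · exact ⟨-a₂, -b₂, -c₂, e, h₂.neg, by push_cast at h ⊢; linear_combination h⟩
  have hcop' : IsCoprime (k₁ : ℤ) (k₂ : ℤ) := Nat.isCoprime_iff_coprime.mpr hcop.symm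
  have hk₁Z : (k₁ : ℤ) ≠ 0 := by exact_mod_cast hk₁0.ne'
  have hk₂Z : (k₂ : ℤ) ≠ 0 := by exact_mod_cast hk₂0.ne'
  set P := Submodule.span ℤ {1, τ₁} * Submodule.span ℤ {1, τ₂} with hPdef
  have hP : ∀ x, x ∈ P ↔ ∃ A B C D : ℤ, x = A + B * τ₁ + C * τ₂ + D * (τ₁ * τ₂) :=
    fun x => mem_mul_span_iff
  have hsmul : ∀ m : ℕ, m • (Submodule.Quotient.mk z : K ⧸ P) = 0 ↔ (m * z : K) ∈ P := by
    intro m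
    rw [← Submodule.Quotient.mk_smul, Submodule.Quotient.mk_eq_zero, nsmul_eq_mul]
  have hn0 : 0 < n := by
    rw [hn, addOrderOf_pos_iff, isOfFinAddOrder_iff_nsmul_eq_zero]
    obtain ⟨d, m, k, hd0, hdz⟩ := exists_int_mul_mem hdeg hτ₁ z
    refine ⟨d.toNat, by omega, (hsmul _).mpr ((hP _).mpr ⟨m, k, 0, 0, ?_⟩)⟩
    have : ((d.toNat : ℤ) : K) = d := by rw [Int.toNat_of_nonneg hd0.le]
    rw [Int.cast_natCast] at this
    rw [this, hdz]
    simp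
  have hnZ : (n : ℤ) ≠ 0 := by exact_mod_cast hn0.ne'
  obtain ⟨A, B, C, D, hnz⟩ := (hP _).mp ((hsmul n).mp (hn ▸ addOrderOf_nsmul_eq_zero _))
  -- the off-diagonal entries of the multiplication by `n k₁ a₁ τ₁`
  obtain ⟨r, s, hz⟩ : ∃ r s : ℤ, -(((n * k₁ : ℤ) : K) * a₁ * z) = r * τ₂ + s := by
    refine ⟨-(k₁ * a₁ * C + e * D + k₂ * a₂ * B - k₂ * b₂ * D),
      -(k₁ * a₁ * A + e * B - k₂ * c₂ * D), ?_⟩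
    push_cast at hω ⊢
    linear_combination -k₁ * a₁ * hnz - (B + D * τ₂) * hω - k₂ * D * h₂.eq_zero
  obtain ⟨r', s', hz'⟩ : ∃ r' s' : ℤ,
      ((n * k₁ : ℤ) : K) * (a₁ * τ₁ + b₁) * z = r' * τ₂ + s' := by
    refine ⟨e * C + k₂ * a₂ * A - k₂ * b₂ * C + k₁ * b₁ * C - k₁ * c₁ * D,
      e * A - k₂ * c₂ * C + k₁ * b₁ * A - k₁ * c₁ * B, ?_⟩
    push_cast at hω ⊢
    linear_combination k₁ * (a₁ * τ₁ + b₁) * hnz + (A + C * τ₂) * hω + k₂ * C * h₂.eq_zero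
      + k₁ * (B + D * τ₂) * h₁.eq_zero
  have hR : ∀ p : ℕ, p.Prime → (p : ℤ) ∣ n * k₁ → (p : ℤ) ∣ n * k₂ →
      ¬ ((p : ℤ) ∣ r ∧ (p : ℤ) ∣ s ∧ (p : ℤ) ∣ r' ∧ (p : ℤ) ∣ s') := by
    rintro p hp hp₁ hp₂ ⟨⟨x, rfl⟩, ⟨y, rfl⟩, ⟨x', rfl⟩, ⟨y', rfl⟩⟩
    have hpn : p ∣ n := by
      obtain ⟨u, v, huv⟩ := hcop'
      have hdvd : (p : ℤ) ∣ n := by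
        have := dvd_add (hp₁.mul_left u) (hp₂.mul_left v)
        rwa [show u * (n * k₁) + v * (n * k₂) = (n : ℤ) by linear_combination n * huv] at this
      exact_mod_cast hdvd
    obtain ⟨k, rfl⟩ := hpn
    have hp0 : (p : K) ≠ 0 := by exact_mod_cast hp.ne_zero
    have hmem : (k * z : K) ∈ P := by
      refine (hP _).mpr (exists_coords_of_conj_mul_mem hτ₂ h₁ h₂ hk₁Z hk₂Z hcop' hω
        (u := -y) (v := -x) (u' := y') (v' := x') ?_ ?_)
      · apply mul_left_cancel₀ hp0
        push_cast at hz ⊢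
        linear_combination -hz
      · apply mul_left_cancel₀ hp0
        push_cast at hz' ⊢
        linear_combination hz'
    have hle := Nat.le_of_dvd (Nat.pos_of_mul_pos_left hn0)
      (hn ▸ addOrderOf_dvd_of_nsmul_eq_zero ((hsmul k).mpr hmem))
    have := hp.two_le
    nlinarith [Nat.pos_of_mul_pos_left hn0]
  obtain ⟨v, l, hv, hl⟩ := exists_cyclic_vector (e := n * e) (mul_ne_zero hnZ hk₁Z)
    (mul_ne_zero hnZ hk₂Z) h₁.not_dvd h₂.not_dvd (h₁.form_anisotropic hτ₁) hR
  have hω' : (((n * k₁ : ℤ) : K) * a₁ * τ₁) = ((n * e : ℤ) : K) + ((n * k₂ : ℤ) : K) * a₂ * τ₂ := by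
    push_cast at hω ⊢
    linear_combination n * hω
  obtain ⟨p, q, X1, X2, X3, X4⟩ := exists_linear_form hτ₂ h₁ h₂ (mul_ne_zero hnZ hk₁Z)
    (mul_ne_zero hnZ hk₂Z) hω' hz hz' (l 0) (l 1) (l 2) (l 3)
  have hO : ∀ x, x ∈ orderLat K (n * f) ↔
      ∃ m k : ℤ, x = m + k * (((n * k₁ : ℤ) : K) * a₁ * τ₁) := by
    intro x
    rw [hf₁, ← mul_assoc]
    have := mem_orderSet_iff hτ₁ h₁ hc₁ (n * k₁) x
    push_cast at this ⊢
    exact this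
  have hLmem : ∀ x, x ∈ L ↔ ∃ A B C D : ℤ, x = ![A * τ₂ + B + C * z, C * τ₁ + D] := by
    intro x
    rw [hL]
    exact mem_span_period_iff
  obtain ⟨v₀, v₁, v₂, v₃, rfl⟩ : ∃ v₀ v₁ v₂ v₃, v = ![v₀, v₁, v₂, v₃] :=
    ⟨v 0, v 1, v 2, v 3, by ext i; fin_cases i <;> rfl⟩
  rw [actionMatrix_mulVec] at hl
  simp only [dotProduct, Fin.sum_univ_four, Matrix.cons_val] at hv hl
  refine exists_map_eq_latPair (p := p) (q := q) hLmem hP hO ?_ ?_ ?_ ?_ ?_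
    ((hLmem _).mpr ⟨v₀, v₁, v₂, v₃, rfl⟩) ?_
  · intro x hx
    obtain ⟨A, B, C, D, rfl⟩ := (hLmem x).mp hx
    refine (hLmem _).mpr ⟨(n * e - n * k₂ * b₂) * A + n * k₂ * a₂ * B + r' * C + r * D,
      -(n * k₂ * c₂) * A + n * e * B + s' * C + s * D,
      -(n * k₁ * b₁) * C + n * k₁ * a₁ * D, -(n * k₁ * c₁) * C, ?_⟩
    push_cast at hω' hz hz'
    ext i
    fin_cases i
    · simp
      linear_combination (A * τ₂ + B) * hω' + n * k₂ * A * h₂.eq_zero + C * hz' + D * hz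
    · simp
      linear_combination n * k₁ * C * h₁.eq_zero
  · rw [X1]
    refine (hO _).mpr ⟨(n * e - n * k₂ * b₂) * l 0 - n * k₂ * c₂ * l 1 + l 0 * (n * k₁ * b₁),
      l 0, ?_⟩
    push_cast
    ring
  · rw [X2]
    refine (hO _).mpr ⟨n * k₂ * a₂ * l 0 + n * e * l 1 + l 1 * (n * k₁ * b₁), l 1, ?_⟩
    push_cast
    ring
  · rw [X3]
    refine (hO _).mpr ⟨r' * l 0 + s' * l 1 - n * k₁ * b₁ * l 2 - n * k₁ * c₁ * l 3
      + l 2 * (n * k₁ * b₁), l 2, ?_⟩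
    push_cast
    ring
  · rw [X4]
    refine (hO _).mpr ⟨r * l 0 + s * l 1 + n * k₁ * a₁ * l 2 + l 3 * (n * k₁ * b₁), l 3, ?_⟩
    push_cast
    ring
  · have hv' := congrArg (Int.cast (R := K)) hv
    have hl' := congrArg (Int.cast (R := K)) hl
    push_cast at hv' hl' X1 X2 X3 X4
    simp only [Matrix.cons_val_zero, Matrix.cons_val_one]
    linear_combination v₀ * X1 + v₁ * X2 + v₂ * X3 + v₃ * X4 + hl'
      + (n * k₁ * a₁ * τ₁ + n * k₁ * b₁) * hv'

end
end
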